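/- arXiv:1812.04961 — 11 statements merged into one kernel-verified Lean document; each statement's English description precedes it below -/
import Mathlib

section
/- Let N, M be positive integers, let 𝒜 ⊆ (Fin N) × (Fin N) be a set of state-to-state edges (a pair (j,i) means an edge from state node j to state node i) and ℬ ⊆ (Fin M) × (Fin N) a set of input-to-state edges (a pair (k,i) means an edge from input node k to state node i). Then the following are equivalent: (1) there exist real matrices A of size N×N and B of size N×M whose supports match the edge sets exactly (A i j ≠ 0 if and only if (j,i) ∈ 𝒜, and B i k ≠ 0 if and only if (k,i) ∈ ℬ) such that the pair (A,B) is controllable, i.e. the N×(N·M) controllability matrix [B, AB, A²B, …, A^{N−1}B] has rank N; (2) both of the following hold: (a) every state node i ∈ Fin N is reachable from some input node, i.e. there exist k ∈ Fin M and j₀ ∈ Fin N with (k,j₀) ∈ ℬ and a (possibly empty) directed path in 𝒜 from j₀ to i; and (b) there exists an injective map g : Fin N → (Fin N) ⊕ (Fin M) such that for every i, if g i = Sum.inl j then (j,i) ∈ 𝒜 and if g i = Sum.inr k then (k,i) ∈ ℬ (this map encodes a disjoint union of cycles and input-rooted paths covering all state nodes). -/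
open Matrix

theorem Matrix.rank_eq_card_iff_forall_vecMul_eq_zero {K n p : Type*} [Field K] [Fintype n]
    [Fintype p] (C : Matrix n p K) :
    C.rank = Fintype.card n ↔ ∀ v : n → K, v ᵥ* C = 0 → v = 0 := by
  have h : C.rank = Fintype.card n ↔ LinearIndependent K C.row := by
    rw [linearIndependent_iff_card_eq_finrank_span, Matrix.rank_eq_finrank_span_row, eq_comm]
    rfl
  rw [h, ← Matrix.vecMul_injective_iff]
  exact injective_iff_map_eq_zero (Matrix.vecMulLinear C)

/-- A matrix with independent rows has a system of distinct columns carrying nonzero entries. -/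
theorem Matrix.exists_injective_forall_apply_ne_zero {K n p : Type*} [Field K] [Fintype n]
    [Fintype p] (C : Matrix n p K) (hC : ∀ v : n → K, v ᵥ* C = 0 → v = 0) :
    ∃ g : n → p, Function.Injective g ∧ ∀ i, C i (g i) ≠ 0 := by
  classical
  suffices h : ∃ g : n → p, Function.Injective g ∧
      ∀ i, g i ∈ (Finset.univ.filter fun j => C i j ≠ 0) by simpa using h
  rw [← Finset.all_card_le_biUnion_card_iff_exists_injective]
  intro s
  by_contra! hs
  set t := s.biUnion fun i => Finset.univ.filter fun j => C i j ≠ 0 with ht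
  have hdep : ¬ LinearIndependent K (fun (i : s) (j : t) => C i j) := fun h => by
    have := h.fintype_card_le_finrank
    simp only [Fintype.card_coe, Module.finrank_fintype_fun_eq_card] at this
    omega
  obtain ⟨c, hc, i₀, hi₀⟩ := Fintype.not_linearIndependent_iff.1 hdep
  refine hi₀ ?_
  have hv := hC (fun i => if h : i ∈ s then c ⟨i, h⟩ else 0) ?_
  · simpa using congrFun hv i₀
  · funext j
    simp only [Matrix.vecMul, dotProduct, Pi.zero_apply]
    rw [← Finset.sum_subset s.subset_univ (fun i _ hi => by simp [hi]), ← Finset.sum_coe_sort s]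
    by_cases hj : j ∈ t
    · simpa using congrFun hc ⟨j, hj⟩
    · refine Finset.sum_eq_zero fun i _ => ?_
      have : C i j = 0 := by
        by_contra h
        exact hj (Finset.mem_biUnion.2 ⟨i, i.2, by simpa using h⟩)
      simp [this]

theorem Matrix.vecMul_controllability_eq_zero_iff {K : Type*} [Field K] {N M : ℕ}
    (A : Matrix (Fin N) (Fin N) K) (B : Matrix (Fin N) (Fin M) K) (v : Fin N → K) :
    v ᵥ* (Matrix.of fun (i : Fin N) (p : Fin N × Fin M) => (A ^ (p.1 : ℕ) * B) i p.2) = 0 ↔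
      ∀ k : ℕ, v ᵥ* (A ^ k * B) = 0 := by
  constructor
  · intro h
    have hlt : ∀ k < N, v ᵥ* (A ^ k * B) = 0 := fun k hk => by
      funext j
      exact congrFun h (⟨k, hk⟩, j)
    intro k
    rw [Matrix.pow_eq_aeval_mod_charpoly, Polynomial.aeval_eq_sum_range, Matrix.sum_mul,
      Matrix.vecMul_sum]
    refine Finset.sum_eq_zero fun i _ => ?_
    by_cases hi : i < N
    · rw [Matrix.smul_mul, Matrix.vecMul_smul, hlt i hi, smul_zero]
    · rw [Polynomial.coeff_eq_zero_of_degree_lt, zero_smul, Matrix.zero_mul, Matrix.vecMul_zero]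
      refine (Polynomial.degree_modByMonic_lt _ A.charpoly_monic).trans_le ?_
      rw [Matrix.charpoly_degree_eq_dim, Fintype.card_fin]
      exact_mod_cast not_lt.1 hi
  · intro h
    funext p
    exact congrFun (h p.1) p.2

/-- The Popov–Belevitch–Hautus condition, restricted to left vectors supported on `S`. -/
def HautusOn {n m : Type*} [Fintype n] (S : Set n) (A : Matrix n n ℂ) (B : Matrix n m ℂ) : Prop :=
  ∀ (l : ℂ) (v : n → ℂ), (∀ i ∉ S, v i = 0) → v ᵥ* A = l • v → v ᵥ* B = 0 → v = 0

section

variable {n m : Type*} [Fintype n]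

theorem HautusOn.eq_zero_of_mem {S : Set n} {A : Matrix n n ℂ} {B : Matrix n m ℂ}
    (h : HautusOn S A B) (V : Submodule ℂ (n → ℂ)) (hS : ∀ v ∈ V, ∀ i ∉ S, v i = 0)
    (hA : ∀ v ∈ V, v ᵥ* A ∈ V) (hB : ∀ v ∈ V, v ᵥ* B = 0) {v : n → ℂ} (hv : v ∈ V) : v = 0 := by
  by_contra hne
  have : Nontrivial V := ⟨⟨⟨v, hv⟩, 0, fun h => hne (congrArg Subtype.val h)⟩⟩
  obtain ⟨l, hl⟩ := Module.End.exists_eigenvalue ((Matrix.vecMulLinear A).restrict hA)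
  obtain ⟨w, hw⟩ := hl.exists_hasEigenvector
  refine hw.2 (Subtype.ext (h l w (hS w w.2) ?_ (hB w w.2)))
  exact congrArg Subtype.val hw.apply_eq_smul

/-- For a controllable pair, `(l, u) ↦ (u (l - A), - u B)` takes a given nonzero value only for
finitely many `l`. -/
theorem HautusOn.finite_setOf_exists {S : Set n} {A : Matrix n n ℂ} {B : Matrix n m ℂ}
    (h : HautusOn S A B) (e : n → ℂ) (b : m → ℂ) (hne : e ≠ 0 ∨ b ≠ 0) :
    {l : ℂ | ∃ u : n → ℂ, (∀ i ∉ S, u i = 0) ∧ u ᵥ* A + e = l • u ∧ u ᵥ* B + b = 0}.Finite := by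
  by_contra hinf
  set N := Fintype.card n + 1 with hN
  set L := Set.Infinite.natEmbedding _ hinf
  set l : Fin N → ℂ := fun i => (L i : ℂ) with hl
  have hlinj : Function.Injective l := fun i j hij =>
    Fin.ext (L.injective (Subtype.ext hij))
  have hex : ∀ i : Fin N, ∃ u : n → ℂ, (∀ j ∉ S, u j = 0) ∧ u ᵥ* A + e = l i • u ∧
      u ᵥ* B + b = 0 := fun i => (L i).2
  choose u huS huA huB using hex
  have huA' : ∀ i, u i ᵥ* A = l i • u i - e := fun i => eq_sub_of_add_eq (huA i)
  have huB' : ∀ i, u i ᵥ* B = -b := fun i => eq_neg_of_add_eq_zero_left (huB i)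
  have hdep : ¬ LinearIndependent ℂ u := fun hli => by
    have := hli.fintype_card_le_finrank
    simp [hN] at this
  obtain ⟨c, hc, i₀, hi₀⟩ := Fintype.not_linearIndependent_iff.1 hdep
  have hsum : ∀ k, ∑ i, (c i * l i ^ k) • u i = 0 →
      ∑ i, (c i * l i ^ (k + 1)) • u i = (∑ i, c i * l i ^ k) • e ∧
      (∑ i, c i * l i ^ k) • b = 0 := by
    intro k hk
    constructor
    · have := congrArg (· ᵥ* A) hk
      simp only [Matrix.sum_vecMul, Matrix.smul_vecMul, huA', smul_sub, smul_smul,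
        Finset.sum_sub_distrib, Matrix.zero_vecMul, ← Finset.sum_smul] at this
      rw [← sub_eq_zero, ← this]
      simp only [pow_succ, mul_assoc]
    · have := congrArg (· ᵥ* B) hk
      simpa only [Matrix.sum_vecMul, Matrix.smul_vecMul, huB', smul_neg,
        Finset.sum_neg_distrib, Matrix.zero_vecMul, ← Finset.sum_smul, neg_eq_zero] using this
  have hzero : ∀ k, ∑ i, (c i * l i ^ k) • u i = 0 → ∑ i, c i * l i ^ k = 0 := by
    intro k hk
    obtain ⟨he, hb⟩ := hsum k hk
    by_contra hs
    have hb0 : b = 0 := (smul_eq_zero.1 hb).resolve_left hs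
    have heV : e ∈ Submodule.span ℂ (Set.range u) := by
      rw [← Submodule.smul_mem_iff _ hs, ← he]
      exact Submodule.sum_mem _ fun i _ => Submodule.smul_mem _ _ (Submodule.subset_span ⟨i, rfl⟩)
    have he0 : e = 0 := by
      refine h.eq_zero_of_mem (Submodule.span ℂ (Set.range u)) ?_ ?_ ?_ heV
      · intro v hv j hj
        have hle : Submodule.span ℂ (Set.range u) ≤ LinearMap.ker (LinearMap.proj j) := by
          rw [Submodule.span_le]
          rintro _ ⟨i, rfl⟩
          exact huS i j hj
        exact hle hv
      · intro v hv
        have hle : Submodule.span ℂ (Set.range u) ≤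
            (Submodule.span ℂ (Set.range u)).comap (Matrix.vecMulLinear A) := by
          rw [Submodule.span_le]
          rintro _ ⟨i, rfl⟩
          change u i ᵥ* A ∈ Submodule.span ℂ (Set.range u)
          rw [huA']
          exact Submodule.sub_mem _ (Submodule.smul_mem _ _ (Submodule.subset_span ⟨i, rfl⟩)) heV
        exact hle hv
      · intro v hv
        have hle : Submodule.span ℂ (Set.range u) ≤ LinearMap.ker (Matrix.vecMulLinear B) := by
          rw [Submodule.span_le]
          rintro _ ⟨i, rfl⟩
          change u i ᵥ* B = 0
          rw [huB', hb0, neg_zero]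
        exact hle hv
    exact hne.elim (fun h => h he0) (fun h => h hb0)
  have hall : ∀ k, ∑ i, (c i * l i ^ k) • u i = 0 := by
    intro k
    induction k with
    | zero => simpa using hc
    | succ k ih => rw [(hsum k ih).1, hzero k ih, zero_smul]
  have := Matrix.eq_zero_of_forall_pow_sum_mul_pow_eq_zero hlinj
    (v := c) fun k => hzero k (hall k)
  exact hi₀ (congrFun this i₀)

/-- A real pair supported in the given edge sets, living on `S` and controllable there. -/
structure IsRealizationOn (𝒜 : Set (n × n)) (ℬ : Set (m × n)) (S : Set n) (A : Matrix n n ℝ)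
    (B : Matrix n m ℝ) : Prop where
  mem_of_A_ne_zero : ∀ i j, A i j ≠ 0 → (j, i) ∈ 𝒜 ∧ i ∈ S ∧ j ∈ S
  mem_of_B_ne_zero : ∀ i k, B i k ≠ 0 → (k, i) ∈ ℬ ∧ i ∈ S
  hautusOn : HautusOn S (A.map Complex.ofReal) (B.map Complex.ofReal)

/-- The states lying on an input-rooted path of the cover `g`. -/
inductive IsStem (g : n → n ⊕ m) : n → Prop
  | root {i : n} {k : m} : g i = Sum.inr k → IsStem g i
  | step {i j : n} : g i = Sum.inl j → IsStem g j → IsStem g i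

theorem exists_isRealizationOn_stem {𝒜 : Set (n × n)} {ℬ : Set (m × n)} {g : n → n ⊕ m}
    (hg : Function.Injective g) (hg𝒜 : ∀ i j, g i = Sum.inl j → (j, i) ∈ 𝒜)
    (hgℬ : ∀ i k, g i = Sum.inr k → (k, i) ∈ ℬ) :
    ∃ A B, IsRealizationOn 𝒜 ℬ {i | IsStem g i} A B := by
  classical
  refine ⟨Matrix.of fun i j => if g i = Sum.inl j ∧ IsStem g j then 1 else 0,
    Matrix.of fun i k => if g i = Sum.inr k then 1 else 0, ?_, ?_, ?_⟩
  · intro i j h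
    have h' : g i = Sum.inl j ∧ IsStem g j := by
      by_contra h'
      exact h (if_neg h')
    exact ⟨hg𝒜 i j h'.1, IsStem.step h'.1 h'.2, h'.2⟩
  · intro i k h
    have h' : g i = Sum.inr k := by
      by_contra h'
      exact h (if_neg h')
    exact ⟨hgℬ i k h', IsStem.root h'⟩
  · intro l v hv hA hB
    have key : ∀ i, IsStem g i → v i = 0 := by
      intro i hi
      induction hi with
      | @root i k hik =>
        have := congrFun hB k
        simp only [Matrix.vecMul, dotProduct, Matrix.map_apply, Matrix.of_apply] at this
        rw [Finset.sum_eq_single i] at this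
        · simpa [hik] using this
        · intro i' _ hne
          rw [if_neg fun h => hne (hg (h.trans hik.symm))]
          simp
        · simp
      | @step i j hij hj ih =>
        have := congrFun hA j
        simp only [Matrix.vecMul, dotProduct, Matrix.map_apply, Matrix.of_apply, Pi.smul_apply,
          ih, smul_zero] at this
        rw [Finset.sum_eq_single i] at this
        · simpa [hij, hj] using this
        · intro i' _ hne
          rw [if_neg fun h => hne (hg (h.1.trans hij.symm))]
          simp
        · simp
    funext i
    by_cases hi : IsStem g i
    · exact key i hi
    · exact hv i hi

/-- Any realization on a set closed under successors along `g` extends to a further cycle. -/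
theorem IsRealizationOn.exists_extension {𝒜 : Set (n × n)} {ℬ : Set (m × n)} {g : n → n ⊕ m}
    (hg : Function.Injective g) (hg𝒜 : ∀ i j, g i = Sum.inl j → (j, i) ∈ 𝒜)
    {S : Set n} {A : Matrix n n ℝ} {B : Matrix n m ℝ} (h : IsRealizationOn 𝒜 ℬ S A B)
    (hroot : ∀ i k, g i = Sum.inr k → i ∈ S) (hstep : ∀ i j, g i = Sum.inl j → j ∈ S → i ∈ S)
    {x : n} (hx : x ∉ S) {y : n ⊕ m} (hy𝒜 : ∀ j, y = Sum.inl j → (j, x) ∈ 𝒜 ∧ j ∈ S)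
    (hyℬ : ∀ k, y = Sum.inr k → (k, x) ∈ ℬ) :
    ∃ O : Set n, x ∈ O ∧ (∀ i j, g i = Sum.inl j → j ∈ O → i ∈ O) ∧
      ∃ A' B', IsRealizationOn 𝒜 ℬ (S ∪ O) A' B' := by
  classical
  have hex : ∀ i : {i // i ∉ S}, ∃ j : {j // j ∉ S}, g i = Sum.inl j.1 := by
    rintro ⟨i, hi⟩
    cases hgi : g i with
    | inl j => exact ⟨⟨j, fun hj => hi (hstep i j hgi hj)⟩, rfl⟩
    | inr k => exact absurd (hroot i k hgi) hi
  choose f hf using hex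
  have hfinj : Function.Injective f := fun a b hab =>
    Subtype.ext (hg ((hf a).trans (hab ▸ (hf b).symm)))
  obtain ⟨p, hp, hper⟩ := hfinj.mem_periodicPts ⟨x, hx⟩
  set z : ℕ → {i // i ∉ S} := fun t => f^[t] ⟨x, hx⟩ with hz
  have hz0 : z 0 = ⟨x, hx⟩ := rfl
  have hzp : z p = ⟨x, hx⟩ := hper
  have hzs : ∀ t, z (t + 1) = f (z t) := fun t => Function.iterate_succ_apply' f t _
  have hgz : ∀ t, g (z t) = Sum.inl (z (t + 1)).1 := fun t => by rw [hzs, hf]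
  set O : Set n := Set.range fun t => (z t).1 with hO
  have hOS : ∀ i ∈ O, i ∉ S := by
    rintro _ ⟨t, rfl⟩
    exact (z t).2
  have hOnext : ∀ i j, i ∈ O → g i = Sum.inl j → j ∈ O := by
    rintro _ j ⟨t, rfl⟩ hij
    exact ⟨t + 1, Sum.inl_injective ((hgz t).symm.trans hij)⟩
  have hOprev : ∀ i j, g i = Sum.inl j → j ∈ O → i ∈ O := by
    rintro i _ hij ⟨t, rfl⟩
    cases t with
    | zero =>
      refine ⟨p - 1, hg ((hgz _).trans ?_)⟩
      rw [Nat.sub_add_cancel hp, hzp]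
      exact hij.symm
    | succ t => exact ⟨t, hg ((hgz t).trans hij.symm)⟩
  refine ⟨O, ⟨0, rfl⟩, hOprev, ?_⟩
  set e : n → ℂ := fun j => if y = Sum.inl j then 1 else 0 with he
  set b : m → ℂ := fun k => if y = Sum.inr k then 1 else 0 with hb
  have hne : e ≠ 0 ∨ b ≠ 0 := by
    cases y with
    | inl j => exact Or.inl fun h => by simpa [he] using congrFun h j
    | inr k => exact Or.inr fun h => by simpa [hb] using congrFun h k
  have hfin := h.hautusOn.finite_setOf_exists e b hne
  obtain ⟨w, hw0, hw⟩ : ∃ w : ℕ, w ≠ 0 ∧ (w : ℂ) ^ p ∉ (fun l : ℂ => l ^ p) ''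
      {l : ℂ | ∃ u : n → ℂ, (∀ i ∉ S, u i = 0) ∧ u ᵥ* A.map Complex.ofReal + e = l • u ∧
        u ᵥ* B.map Complex.ofReal + b = 0} := by
    have hinj : Function.Injective fun w : ℕ => ((w : ℂ) + 1) ^ p := by
      intro a c hac
      have : (a + 1) ^ p = (c + 1) ^ p := by
        beta_reduce at hac
        exact_mod_cast hac
      simpa using Nat.pow_left_injective (by omega : p ≠ 0) this
    obtain ⟨_, ⟨w, rfl⟩, hw⟩ := (Set.infinite_range_of_injective hinj).exists_notMem_finite
      (hfin.image fun l : ℂ => l ^ p)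
    exact ⟨w + 1, w.succ_ne_zero, by push_cast; exact hw⟩
  set P : Matrix n n ℝ := Matrix.of fun i j =>
    (if i ∈ O ∧ g i = Sum.inl j then (w : ℝ) else 0) with hP
  set Q : Matrix n n ℝ := Matrix.of fun i j => (if i = x ∧ y = Sum.inl j then 1 else 0) with hQ
  set R : Matrix n m ℝ := Matrix.of fun i k => (if i = x ∧ y = Sum.inr k then 1 else 0) with hR
  have hxO : x ∈ O := ⟨0, rfl⟩
  refine ⟨A + P + Q, B + R, ?_, ?_, ?_⟩
  · intro i j hij
    by_cases hA : A i j = 0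
    · by_cases hPij : i ∈ O ∧ g i = Sum.inl j
      · exact ⟨hg𝒜 i j hPij.2, .inr hPij.1, .inr (hOnext i j hPij.1 hPij.2)⟩
      · by_cases hQij : i = x ∧ y = Sum.inl j
        · obtain ⟨rfl, hyj⟩ := hQij
          exact ⟨(hy𝒜 j hyj).1, .inr hxO, .inl (hy𝒜 j hyj).2⟩
        · exact absurd (by simp [hP, hQ, hA, hPij, hQij]) hij
    · obtain ⟨h1, h2, h3⟩ := h.mem_of_A_ne_zero i j hA
      exact ⟨h1, .inl h2, .inl h3⟩
  · intro i k hik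
    by_cases hB : B i k = 0
    · by_cases hRik : i = x ∧ y = Sum.inr k
      · obtain ⟨rfl, hyk⟩ := hRik
        exact ⟨hyℬ k hyk, .inr hxO⟩
      · exact absurd (by simp [hR, hB, hRik]) hik
    · obtain ⟨h1, h2⟩ := h.mem_of_B_ne_zero i k hB
      exact ⟨h1, .inl h2⟩
  · intro l v hv hvA hvB
    have hvQ : v ᵥ* Q.map Complex.ofReal = v x • e := by
      funext j
      simp only [Matrix.vecMul, dotProduct, Matrix.map_apply, hQ, Matrix.of_apply, he,
        Pi.smul_apply]
      rw [Finset.sum_eq_single x (fun i _ hi => by simp [hi]) (by simp)]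
      by_cases hyj : y = Sum.inl j <;> simp [hyj]
    have hvR : v ᵥ* R.map Complex.ofReal = v x • b := by
      funext k
      simp only [Matrix.vecMul, dotProduct, Matrix.map_apply, hR, Matrix.of_apply, hb,
        Pi.smul_apply]
      rw [Finset.sum_eq_single x (fun i _ hi => by simp [hi]) (by simp)]
      by_cases hyk : y = Sum.inr k <;> simp [hyk]
    have hvPS : ∀ j ∈ S, (v ᵥ* P.map Complex.ofReal) j = 0 := by
      intro j hj
      simp only [Matrix.vecMul, dotProduct, Matrix.map_apply, hP, Matrix.of_apply]
      refine Finset.sum_eq_zero fun i _ => ?_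
      rw [if_neg fun hi => hOS i hi.1 (hstep i j hi.2 hj)]
      simp
    have hvPO : ∀ i ∈ O, ∀ j, g i = Sum.inl j → (v ᵥ* P.map Complex.ofReal) j = v i * w := by
      intro i hi j hij
      simp only [Matrix.vecMul, dotProduct, Matrix.map_apply, hP, Matrix.of_apply]
      rw [Finset.sum_eq_single i]
      · simp [hi, hij]
      · intro i' _ hne
        rw [if_neg fun h => hne (hg (h.2.trans hij.symm))]
        simp
      · simp
    have hmapA : (A + P + Q).map Complex.ofReal =
        A.map Complex.ofReal + P.map Complex.ofReal + Q.map Complex.ofReal := by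
      ext i j
      simp
    have hmapB : (B + R).map Complex.ofReal = B.map Complex.ofReal + R.map Complex.ofReal := by
      ext i j
      simp
    rw [hmapA, Matrix.vecMul_add, Matrix.vecMul_add, hvQ] at hvA
    rw [hmapB, Matrix.vecMul_add, hvR] at hvB
    have hA0 : ∀ i j, j ∉ S → A i j = 0 := fun i j hj => by
      by_contra hA
      exact hj (h.mem_of_A_ne_zero i j hA).2.2
    have hvA0 : ∀ (v : n → ℂ), ∀ j ∉ S, (v ᵥ* A.map Complex.ofReal) j = 0 := by
      intro v j hj
      simp [Matrix.vecMul, dotProduct, hA0 _ j hj]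
    have he0 : ∀ j ∉ S, e j = 0 := by
      intro j hj
      simp only [he]
      exact if_neg fun hyj => hj (hy𝒜 j hyj).2
    have hcycle : ∀ t, v (z t) * w = l * v (z (t + 1)) := by
      intro t
      have := congrFun hvA (z (t + 1))
      simpa [hvA0 v _ (z (t + 1)).2, he0 _ (z (t + 1)).2, hvPO (z t) ⟨t, rfl⟩ _ (hgz t)] using this
    have hpow : ∀ t, v x * w ^ t = l ^ t * v (z t) := by
      intro t
      induction t with
      | zero => simp [hz0]
      | succ t ih => rw [pow_succ, ← mul_assoc, ih, mul_assoc, hcycle, pow_succ, mul_assoc]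
    have hw0' : (w : ℂ) ≠ 0 := by exact_mod_cast hw0
    set u : n → ℂ := fun i => if i ∈ S then v i else 0 with hu
    have huS : ∀ i ∉ S, u i = 0 := fun i hi => if_neg hi
    have huA : u ᵥ* A.map Complex.ofReal + v x • e = l • u := by
      have huv : u ᵥ* A.map Complex.ofReal = v ᵥ* A.map Complex.ofReal := by
        funext j
        simp only [Matrix.vecMul, dotProduct, Matrix.map_apply]
        refine Finset.sum_congr rfl fun i _ => ?_
        by_cases hA : A i j = 0
        · simp [hA]
        · simp [hu, (h.mem_of_A_ne_zero i j hA).2.1]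
      rw [huv]
      funext j
      by_cases hj : j ∈ S
      · have := congrFun hvA j
        simpa [hvPS j hj, hu, hj] using this
      · simp [hvA0 v j hj, he0 j hj, huS j hj]
    have huB : u ᵥ* B.map Complex.ofReal + v x • b = 0 := by
      rw [← hvB]
      congr 1
      funext k
      simp only [Matrix.vecMul, dotProduct, Matrix.map_apply]
      refine Finset.sum_congr rfl fun i _ => ?_
      by_cases hB : B i k = 0
      · simp [hB]
      · simp [hu, (h.mem_of_B_ne_zero i k hB).2]
    have hvx : v x = 0 := by
      by_contra hvx
      refine hw ⟨l, ⟨(v x)⁻¹ • u, fun i hi => by simp [huS i hi], ?_, ?_⟩, ?_⟩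
      · rw [Matrix.smul_vecMul, smul_comm l, ← huA, smul_add, smul_smul, inv_mul_cancel₀ hvx,
          one_smul]
      · have := congrArg ((v x)⁻¹ • ·) huB
        simpa [Matrix.smul_vecMul, smul_smul, inv_mul_cancel₀ hvx] using this
      · have := hpow p
        rw [hzp, mul_comm] at this
        exact (mul_right_cancel₀ hvx this).symm
    have hvz : ∀ t, v (z t) = 0 := by
      intro t
      by_cases hl : l = 0
      · simpa [hl, hw0'] using hcycle t
      · simpa [hvx, hl] using hpow t
    have hu0 : u = 0 := by
      refine h.hautusOn l u huS ?_ ?_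
      · simpa [hvx] using huA
      · simpa [hvx] using huB
    funext i
    by_cases hi : i ∈ S
    · simpa [hu, hi] using congrFun hu0 i
    · by_cases hi' : i ∈ O
      · obtain ⟨t, rfl⟩ := hi'
        exact hvz t
      · exact hv i fun h => h.elim hi hi'

theorem exists_isRealizationOn_univ {𝒜 : Set (n × n)} {ℬ : Set (m × n)} {g : n → n ⊕ m}
    (hg : Function.Injective g) (hg𝒜 : ∀ i j, g i = Sum.inl j → (j, i) ∈ 𝒜)
    (hgℬ : ∀ i k, g i = Sum.inr k → (k, i) ∈ ℬ)
    (hreach : ∀ i, ∃ k j₀, (k, j₀) ∈ ℬ ∧ Relation.ReflTransGen (fun a b => (a, b) ∈ 𝒜) j₀ i) :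
    ∃ A B, IsRealizationOn 𝒜 ℬ Set.univ A B := by
  let good : Set (Set n) := {S | (∀ i k, g i = Sum.inr k → i ∈ S) ∧
    (∀ i j, g i = Sum.inl j → j ∈ S → i ∈ S) ∧ ∃ A B, IsRealizationOn 𝒜 ℬ S A B}
  have hgood : good.Nonempty := ⟨{i | IsStem g i}, fun _ _ => IsStem.root, fun _ _ => IsStem.step,
    exists_isRealizationOn_stem hg hg𝒜 hgℬ⟩
  obtain ⟨S, ⟨hroot, hstep, A, B, hAB⟩, hmax⟩ := good.toFinite.exists_maximal hgood
  suffices hS : S = Set.univ from ⟨A, B, hS ▸ hAB⟩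
  have hclosed : ∀ x, ∀ y : n ⊕ m, (∀ j, y = Sum.inl j → (j, x) ∈ 𝒜 ∧ j ∈ S) →
      (∀ k, y = Sum.inr k → (k, x) ∈ ℬ) → x ∈ S := by
    intro x y hy𝒜 hyℬ
    by_contra hx
    obtain ⟨O, hxO, hO, hext⟩ := hAB.exists_extension hg hg𝒜 hroot hstep hx hy𝒜 hyℬ
    refine hx (hmax ⟨fun i k hik => .inl (hroot i k hik), fun i j hij hj => ?_, hext⟩
      Set.subset_union_left (Or.inr hxO))
    exact hj.imp (hstep i j hij) (hO i j hij)
  refine Set.eq_univ_of_forall fun i => ?_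
  obtain ⟨k, j₀, hk, hpath⟩ := hreach i
  induction hpath with
  | refl => exact hclosed j₀ (Sum.inr k) (by simp) (by rintro _ ⟨⟩; exact hk)
  | @tail a c _ hac ih => exact hclosed c (Sum.inl a) (by rintro _ ⟨⟩; exact ⟨hac, ih⟩) (by simp)

end

/-- A controllable pair supported in the edge sets can be perturbed to have exactly that support. -/
theorem exists_support_eq_of_controllable {N M : ℕ} {𝒜 : Set (Fin N × Fin N)}
    {ℬ : Set (Fin M × Fin N)} {A : Matrix (Fin N) (Fin N) ℝ} {B : Matrix (Fin N) (Fin M) ℝ}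
    (hA : ∀ i j, A i j ≠ 0 → (j, i) ∈ 𝒜) (hB : ∀ i k, B i k ≠ 0 → (k, i) ∈ ℬ)
    (hrank : Matrix.rank (Matrix.of fun (i : Fin N) (p : Fin N × Fin M) =>
      (A ^ (p.1 : ℕ) * B) i p.2) = N) :
    ∃ (A : Matrix (Fin N) (Fin N) ℝ) (B : Matrix (Fin N) (Fin M) ℝ),
      (∀ i j, A i j ≠ 0 ↔ (j, i) ∈ 𝒜) ∧ (∀ i k, B i k ≠ 0 ↔ (k, i) ∈ ℬ) ∧
      Matrix.rank (Matrix.of fun (i : Fin N) (p : Fin N × Fin M) =>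
        (A ^ (p.1 : ℕ) * B) i p.2) = N := by
  classical
  let A' : ℝ → Matrix (Fin N) (Fin N) ℝ := fun t => A + t • Matrix.of fun i j =>
    if (j, i) ∈ 𝒜 then 1 else 0
  let B' : ℝ → Matrix (Fin N) (Fin M) ℝ := fun t => B + t • Matrix.of fun i k =>
    if (k, i) ∈ ℬ then 1 else 0
  let C : ℝ → Matrix (Fin N) (Fin N × Fin M) ℝ := fun t =>
    Matrix.of fun i p => (A' t ^ (p.1 : ℕ) * B' t) i p.2
  have hA'c : Continuous A' := by fun_prop
  have hB'c : Continuous B' := by fun_prop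
  have hCc : Continuous C := continuous_matrix fun i p =>
    ((hA'c.pow p.1).matrix_mul hB'c).matrix_elem i p.2
  have hdet : ∀ᶠ t in nhdsWithin (0 : ℝ) {0}ᶜ, (C t * (C t)ᵀ).det ≠ 0 := by
    have hc : Continuous fun t => (C t * (C t)ᵀ).det :=
      (hCc.matrix_mul hCc.matrix_transpose).matrix_det
    refine (hc.continuousAt.eventually_ne ?_).filter_mono nhdsWithin_le_nhds
    rw [← isUnit_iff_ne_zero, ← Matrix.isUnit_iff_isUnit_det,
      ← Matrix.linearIndependent_rows_iff_isUnit, ← Matrix.vecMul_injective_iff]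
    refine (injective_iff_map_eq_zero (Matrix.vecMulLinear (C 0 * (C 0)ᵀ))).2
      ((Matrix.rank_eq_card_iff_forall_vecMul_eq_zero _).1 ?_)
    rw [Matrix.rank_self_mul_transpose, Fintype.card_fin]
    simpa [C, A', B'] using hrank
  have hne : ∀ a : ℝ, ∀ᶠ t in nhdsWithin (0 : ℝ) {0}ᶜ, a + t ≠ 0 := by
    intro a
    by_cases ha : a = 0
    · filter_upwards [self_mem_nhdsWithin] with t ht
      simpa [ha] using ht
    · refine ContinuousAt.eventually_ne (g := fun t : ℝ => a + t) (by fun_prop) (by simpa using ha)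
        |>.filter_mono nhdsWithin_le_nhds
  obtain ⟨t, ⟨htdet, htA⟩, htB⟩ := ((hdet.and (Filter.eventually_all.2 fun i =>
    Filter.eventually_all.2 fun j => hne (A i j))).and (Filter.eventually_all.2 fun i =>
    Filter.eventually_all.2 fun k => hne (B i k))).exists
  refine ⟨A' t, B' t, fun i j => ?_, fun i k => ?_, ?_⟩
  · by_cases hij : (j, i) ∈ 𝒜
    · simpa [A', hij] using htA i j
    · simpa [A', hij] using fun h => hij (hA i j h)
  · by_cases hik : (k, i) ∈ ℬ
    · simpa [B', hik] using htB i k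
    · simpa [B', hik] using fun h => hik (hB i k h)
  · change (C t).rank = N
    rw [← Matrix.rank_self_mul_transpose, Matrix.rank_of_isUnit _
      ((Matrix.isUnit_iff_isUnit_det _).2 (isUnit_iff_ne_zero.2 htdet)), Fintype.card_fin]

theorem IsRealizationOn.rank_eq {N M : ℕ} {𝒜 : Set (Fin N × Fin N)} {ℬ : Set (Fin M × Fin N)}
    {A : Matrix (Fin N) (Fin N) ℝ} {B : Matrix (Fin N) (Fin M) ℝ}
    (h : IsRealizationOn 𝒜 ℬ Set.univ A B) :
    Matrix.rank (Matrix.of fun (i : Fin N) (p : Fin N × Fin M) =>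
      (A ^ (p.1 : ℕ) * B) i p.2) = N := by
  have hiff := Matrix.rank_eq_card_iff_forall_vecMul_eq_zero
    (Matrix.of fun (i : Fin N) (p : Fin N × Fin M) => (A ^ (p.1 : ℕ) * B) i p.2)
  rw [Fintype.card_fin] at hiff
  rw [hiff]
  intro v hv
  rw [Matrix.vecMul_controllability_eq_zero_iff] at hv
  set Ac := A.map Complex.ofReal with hAc
  set Bc := B.map Complex.ofReal with hBc
  let V : Submodule ℂ (Fin N → ℂ) := ⨅ k : ℕ, LinearMap.ker (Matrix.vecMulLinear (Ac ^ k * Bc))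
  have hmem : ∀ u, u ∈ V ↔ ∀ k : ℕ, u ᵥ* (Ac ^ k * Bc) = 0 := fun u => by
    simp [V, Submodule.mem_iInf]
  have hvV : (fun i => (v i : ℂ)) ∈ V := by
    rw [hmem]
    intro k
    have hmap : Ac ^ k * Bc = (A ^ k * B).map Complex.ofRealHom := by
      rw [Matrix.map_mul, Matrix.map_pow]
      rfl
    rw [hmap]
    funext j
    have := congrArg Complex.ofReal (congrFun (hv k) j)
    simpa [Matrix.vecMul, dotProduct] using this
  have hv0 := h.hautusOn.eq_zero_of_mem V (by simp)
    (fun u hu => (hmem _).2 fun k => by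
      rw [Matrix.vecMul_vecMul, ← Matrix.mul_assoc, ← pow_succ']
      exact (hmem u).1 hu (k + 1))
    (fun u hu => by simpa using (hmem u).1 hu 0) hvV
  funext i
  simpa using congrFun hv0 i

/-- Lin's theorem: structural controllability of linear systems.
`𝒜` is the set of state-to-state edges ((j,i) means j → i), `ℬ` the set of
input-to-state edges ((k,i) means input k → state i). -/
theorem structural_controllability
    (N M : ℕ) (hN : 0 < N) (hM : 0 < M)
    (𝒜 : Set (Fin N × Fin N)) (ℬ : Set (Fin M × Fin N)) :
    (∃ (A : Matrix (Fin N) (Fin N) ℝ) (B : Matrix (Fin N) (Fin M) ℝ),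
      (∀ i j, A i j ≠ 0 ↔ (j, i) ∈ 𝒜) ∧
      (∀ i k, B i k ≠ 0 ↔ (k, i) ∈ ℬ) ∧
      Matrix.rank (Matrix.of fun (i : Fin N) (p : Fin N × Fin M) =>
        (A ^ (p.1 : ℕ) * B) i p.2) = N)
    ↔
    ((∀ i : Fin N, ∃ (k : Fin M) (j₀ : Fin N), (k, j₀) ∈ ℬ ∧
        Relation.ReflTransGen (fun a b => (a, b) ∈ 𝒜) j₀ i) ∧
     (∃ g : Fin N → (Fin N ⊕ Fin M), Function.Injective g ∧
        ∀ i : Fin N,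
          (∀ j : Fin N, g i = Sum.inl j → (j, i) ∈ 𝒜) ∧
          (∀ k : Fin M, g i = Sum.inr k → (k, i) ∈ ℬ))) := by
  have hiff : ∀ C : Matrix (Fin N) (Fin N × Fin M) ℝ,
      C.rank = N ↔ ∀ v : Fin N → ℝ, v ᵥ* C = 0 → v = 0 := fun C => by
    simpa using Matrix.rank_eq_card_iff_forall_vecMul_eq_zero C
  constructor
  · rintro ⟨A, B, hA, hB, hrank⟩
    rw [hiff] at hrank
    simp only [Matrix.vecMul_controllability_eq_zero_iff] at hrank
    constructor
    · by_contra! hcon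
      obtain ⟨i, hi⟩ := hcon
      have hrow : ∀ (t : ℕ) (i : Fin N), (∀ k j₀, (k, j₀) ∈ ℬ →
          ¬ Relation.ReflTransGen (fun a b => (a, b) ∈ 𝒜) j₀ i) → ∀ k, (A ^ t * B) i k = 0 := by
        intro t
        induction t with
        | zero =>
          intro i hi k
          by_contra h
          exact hi k i ((hB i k).1 (by simpa using h)) .refl
        | succ t ih =>
          intro i hi k
          rw [pow_succ', Matrix.mul_assoc, Matrix.mul_apply]
          refine Finset.sum_eq_zero fun j _ => ?_
          by_cases hij : A i j = 0
          · rw [hij, zero_mul]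
          · rw [ih j fun k j₀ hk hj => hi k j₀ hk (hj.tail ((hA i j).1 hij)), mul_zero]
      have := hrank (Pi.single i 1) fun t => by
        funext k
        simpa using hrow t i hi k
      simpa using congrFun this i
    · obtain ⟨g, hg, hne⟩ := Matrix.exists_injective_forall_apply_ne_zero
        (Matrix.fromCols A B) fun v hv => by
          rw [Matrix.vecMul_fromCols] at hv
          have hvA : v ᵥ* A = 0 := funext fun j => congrFun hv (Sum.inl j)
          have hvB : v ᵥ* B = 0 := funext fun k => congrFun hv (Sum.inr k)
          refine hrank v fun t => ?_
          cases t with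
          | zero => simpa using hvB
          | succ t =>
            rw [pow_succ', Matrix.mul_assoc, ← Matrix.vecMul_vecMul, hvA, Matrix.zero_vecMul]
      refine ⟨g, hg, fun i => ⟨fun j hij => ?_, fun k hik => ?_⟩⟩
      · exact (hA i j).1 (by simpa [hij] using hne i)
      · exact (hB i k).1 (by simpa [hik] using hne i)
  · rintro ⟨hreach, g, hg, hedge⟩
    obtain ⟨A, B, hAB⟩ := exists_isRealizationOn_univ hg (fun i => (hedge i).1)
      (fun i => (hedge i).2) hreach
    exact exists_support_eq_of_controllable (fun i j h => (hAB.mem_of_A_ne_zero i j h).1)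
      (fun i k h => (hAB.mem_of_B_ne_zero i k h).1) hAB.rank_eq
end

section
/- Let N, P be positive integers, let 𝒜 ⊆ (Fin N) × (Fin N) be a set of state-to-state edges (a pair (j,i) means an edge from state node j to state node i) and 𝒞 ⊆ (Fin N) × (Fin P) a set of state-to-output edges (a pair (i,p) means an edge from state node i to output node p). Then the following are equivalent: (1) there exist real matrices A of size N×N and C of size P×N whose supports match the edge sets exactly (A i j ≠ 0 if and only if (j,i) ∈ 𝒜, and C p i ≠ 0 if and only if (i,p) ∈ 𝒞) such that the pair (A,C) is observable, i.e. the (N·P)×N observability matrix obtained by stacking C, CA, CA², …, CA^{N−1} has rank N; (2) both of the following hold: (a) every state node i ∈ Fin N can reach some output node, i.e. there exist j₀ ∈ Fin N and p ∈ Fin P with a (possibly empty) directed path in 𝒜 from i to j₀ and (j₀,p) ∈ 𝒞; and (b) there exists an injective map g : Fin N → (Fin N) ⊕ (Fin P) such that for every i, if g i = Sum.inl j then (i,j) ∈ 𝒜 and if g i = Sum.inr p then (i,p) ∈ 𝒞 (this map encodes a disjoint union of cycles and output-topped paths covering all state nodes). -/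
open Matrix Filter Topology

namespace StructuralObservability

variable {n m : Type*} [Fintype n] [DecidableEq n] [Fintype m]

section LinearAlgebra

theorem vecMulVec_single_one_mulVec {r K : Type*} [CommSemiring K] (u : r → K) (b : n)
    (v : n → K) : vecMulVec u (Pi.single b 1) *ᵥ v = v b • u := by
  rw [vecMulVec_mulVec, single_one_dotProduct, op_smul_eq_smul]

omit [DecidableEq n] in
theorem rank_eq_card_iff {r K : Type*} [Field K] (M : Matrix r n K) :
    M.rank = Fintype.card n ↔ ∀ v, M *ᵥ v = 0 → v = 0 := by
  have h := LinearMap.finrank_range_add_finrank_ker M.mulVecLin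
  rw [Module.finrank_fintype_fun_eq_card] at h
  have hk : (∀ v, M *ᵥ v = 0 → v = 0) ↔ LinearMap.ker M.mulVecLin = ⊥ := by
    rw [LinearMap.ker_eq_bot']
    simp
  rw [hk, ← Submodule.finrank_eq_zero (R := K), Matrix.rank]
  omega

omit [Fintype m] [DecidableEq n] in
/-- A matrix with trivial kernel admits an injective choice of a nonzero entry in each column. -/
theorem exists_injective_of_ker_eq_bot {K : Type*} [Field K] {r : Type*} [Finite r]
    (M : Matrix r n K) (hM : ∀ v, M *ᵥ v = 0 → v = 0) :
    ∃ g : n → r, Function.Injective g ∧ ∀ i, M (g i) i ≠ 0 := by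
  classical
  have := Fintype.ofFinite r
  obtain ⟨g, hg, hgt⟩ := (Finset.all_card_le_biUnion_card_iff_exists_injective
    (fun i : n => Finset.univ.filter fun q : r => M q i ≠ 0)).1 fun s => by
      set t := s.biUnion fun i : n => Finset.univ.filter fun q : r => M q i ≠ 0 with ht
      let N : Matrix t s K := M.submatrix (↑) (↑)
      have hN : Function.Injective N.mulVecLin := by
        rw [injective_iff_map_eq_zero]
        intro v hv
        let w : n → K := fun i => if h : i ∈ s then v ⟨i, h⟩ else 0
        have hw : ∀ q, (M *ᵥ w) q = ∑ i : s, M q i * v i := by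
          intro q
          rw [mulVec, dotProduct, ← Finset.sum_subset (Finset.subset_univ s),
            ← Finset.sum_coe_sort]
          · exact Finset.sum_congr rfl fun i _ => by simp [w]
          · intro i _ hi
            simp [w, hi]
        have hw0 : w = 0 := by
          refine hM w (funext fun q => ?_)
          rw [hw]
          by_cases hq : q ∈ t
          · exact congrFun hv ⟨q, hq⟩
          · refine Finset.sum_eq_zero fun i _ => ?_
            have : M q i = 0 := by
              by_contra h
              exact hq (Finset.mem_biUnion.2 ⟨i, i.2, by simpa using h⟩)
            simp [this]
        funext i
        simpa [w] using congrFun hw0 i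
      simpa using LinearMap.finrank_le_finrank_of_injective hN
  exact ⟨g, hg, fun i => by simpa using hgt i⟩

omit [Fintype m] in
/-- Cayley–Hamilton: the kernel of the observability matrix is annihilated by every `C * A ^ k`. -/
theorem mul_pow_mulVec_eq_zero {K : Type*} [Field K] (A : Matrix n n K) (C : Matrix m n K)
    (v : n → K) (h : ∀ k < Fintype.card n, (C * A ^ k) *ᵥ v = 0) (k : ℕ) :
    (C * A ^ k) *ᵥ v = 0 := by
  rcases isEmpty_or_nonempty n with hn | hn
  · have : v = 0 := Subsingleton.elim _ _
    simp [this]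
  have hd : (Polynomial.X ^ k %ₘ A.charpoly).natDegree < Fintype.card n := by
    rw [← A.charpoly_natDegree_eq_dim]
    refine Polynomial.natDegree_modByMonic_lt _ A.charpoly_monic fun h1 => ?_
    have := A.charpoly_natDegree_eq_dim
    rw [h1, Polynomial.natDegree_one] at this
    exact Fintype.card_ne_zero this.symm
  rw [pow_eq_aeval_mod_charpoly, Polynomial.aeval_eq_sum_range' hd, Matrix.mul_sum,
    Matrix.sum_mulVec]
  refine Finset.sum_eq_zero fun i hi => ?_
  rw [Matrix.mul_smul, Matrix.smul_mulVec, h i (Finset.mem_range.1 hi), smul_zero]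

omit [DecidableEq n] in
theorem mulVec_indicator {r K : Type*} [Semiring K] {M : Matrix r n K} {S : Set n}
    (hM : ∀ i j, j ∉ S → M i j = 0) (v : n → K) : M *ᵥ S.indicator v = M *ᵥ v := by
  funext i
  refine Finset.sum_congr rfl fun j _ => ?_
  by_cases hj : j ∈ S <;> simp [hj, hM]

end LinearAlgebra

/-- `A` and `C` are observable on the coordinates in `S`, in the form of the eigenvector test. -/
def ObservableOn (S : Set n) (A : Matrix n n ℂ) (C : Matrix m n ℂ) : Prop :=
  ∀ (μ : ℂ) (v : n → ℂ), (∀ i ∈ S, (A *ᵥ v) i = μ * v i) → C *ᵥ v = 0 → ∀ i ∈ S, v i = 0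

omit [Fintype m] in
theorem ObservableOn.eq_zero {S : Set n} {A : Matrix n n ℂ} {C : Matrix m n ℂ}
    (h : ObservableOn S A C) (hA : ∀ i j, i ∉ S → A i j = 0) {v : n → ℂ}
    (hv : ∀ i ∉ S, v i = 0) (hCv : ∀ k, (C * A ^ k) *ᵥ v = 0) : v = 0 := by
  let U : Submodule ℂ (n → ℂ) :=
    { carrier := {u | (∀ i ∉ S, u i = 0) ∧ ∀ k, (C * A ^ k) *ᵥ u = 0}
      add_mem' := fun {a b} ha hb =>
        ⟨fun i hi => by simp [ha.1 i hi, hb.1 i hi],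
          fun k => by rw [mulVec_add, ha.2, hb.2, add_zero]⟩
      zero_mem' := ⟨by simp, by simp⟩
      smul_mem' := fun c u hu =>
        ⟨fun i hi => by simp [hu.1 i hi], fun k => by rw [mulVec_smul, hu.2, smul_zero]⟩ }
  have hAU : ∀ u ∈ U, A.mulVecLin u ∈ U := by
    rintro u ⟨-, hu⟩
    refine ⟨fun i hi => ?_, fun k => ?_⟩
    · simp [mulVec, dotProduct, hA i _ hi]
    · have := hu (k + 1)
      rwa [pow_succ, ← Matrix.mul_assoc, ← mulVec_mulVec] at this
  by_contra hne
  have : Nontrivial U := ⟨⟨⟨v, hv, hCv⟩, 0, fun h => hne (congrArg Subtype.val h)⟩⟩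
  obtain ⟨μ, hμ⟩ := Module.End.exists_eigenvalue (A.mulVecLin.restrict hAU)
  obtain ⟨u, hu⟩ := hμ.exists_hasEigenvector
  refine hu.2 (Subtype.ext (funext fun i => ?_))
  by_cases hi : i ∈ S
  · refine h μ u (fun i _ => ?_) (by simpa using u.2.2 0) i hi
    exact congrFun (congrArg Subtype.val hu.apply_eq_smul) i
  · exact u.2.1 i hi

omit [DecidableEq n] in
theorem exists_norm_mulVec_le {r : Type*} [Fintype r] (M : Matrix r n ℂ) :
    ∃ a, 0 ≤ a ∧ ∀ v, ‖M *ᵥ v‖ ≤ a * ‖v‖ :=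
  ⟨‖LinearMap.toContinuousLinearMap M.mulVecLin‖, norm_nonneg _,
    fun v => (LinearMap.toContinuousLinearMap M.mulVecLin).le_opNorm v⟩

/-- The transfer function `y + C (μ - A)⁻¹ x` has no zero near infinity. -/
def TransferNonvanishing (A : Matrix n n ℂ) (C : Matrix m n ℂ) (x : n → ℂ) (y : m → ℂ) : Prop :=
  ∃ W : ℝ, ∀ μ : ℂ, W < ‖μ‖ → ∀ (v : n → ℂ) (z : ℂ),
    A *ᵥ v + z • x = μ • v → C *ᵥ v + z • y = 0 → z = 0

omit [DecidableEq n] [Fintype m] in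
theorem transferNonvanishing_of_output (A : Matrix n n ℂ) (C : Matrix m n ℂ) {y : m → ℂ}
    (hy : y ≠ 0) : TransferNonvanishing A C 0 y := by
  obtain ⟨a, ha, hA⟩ := exists_norm_mulVec_le A
  refine ⟨a, fun μ hμ v z hv hz => ?_⟩
  have hv0 : v = 0 := by
    have h := hA v
    rw [show A *ᵥ v = μ • v by simpa using hv, norm_smul] at h
    by_contra hne
    have := norm_pos_iff.2 hne
    nlinarith
  simpa [hv0, hy] using hz

theorem transferNonvanishing_of_markov {A : Matrix n n ℂ} {C : Matrix m n ℂ} {x : n → ℂ}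
    (h : ∃ k, (C * A ^ k) *ᵥ x ≠ 0) : TransferNonvanishing A C x 0 := by
  classical
  let k := Nat.find h
  have hk : (C * A ^ k) *ᵥ x ≠ 0 := Nat.find_spec h
  have hlt : ∀ l < k, (C * A ^ l) *ᵥ x = 0 := fun l hl => not_not.1 (Nat.find_min h hl)
  obtain ⟨a, ha, hA⟩ := exists_norm_mulVec_le A
  obtain ⟨b, hb, hB⟩ := exists_norm_mulVec_le (C * A ^ (k + 1))
  set c := (C * A ^ k) *ᵥ x
  have hc : 0 < ‖c‖ := norm_pos_iff.2 hk
  refine ⟨a + b * ‖x‖ / ‖c‖, fun μ hμ v z hv hz => ?_⟩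
  have hrec : ∀ l, (C * A ^ (l + 1)) *ᵥ v + z • ((C * A ^ l) *ᵥ x) = μ • ((C * A ^ l) *ᵥ v) := by
    intro l
    rw [← mulVec_smul, ← mulVec_smul, ← hv, mulVec_add, mulVec_mulVec, pow_succ,
      Matrix.mul_assoc]
  have hvan : ∀ l ≤ k, (C * A ^ l) *ᵥ v = 0 := by
    intro l
    induction l with
    | zero => intro _; simpa using hz
    | succ l ih =>
      intro hl
      have := hrec l
      rwa [ih (by omega), hlt l (by omega), smul_zero, smul_zero, add_zero] at this
  have hz1 : ‖z‖ * ‖c‖ ≤ b * ‖v‖ := by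
    have h1 := hrec k
    rw [hvan k le_rfl, smul_zero, add_eq_zero_iff_eq_neg] at h1
    have h2 := hB v
    rwa [h1, norm_neg, norm_smul] at h2
  have hz2 : (‖μ‖ - a) * ‖v‖ ≤ ‖z‖ * ‖x‖ := by
    have h1 : ‖μ‖ * ‖v‖ ≤ ‖A *ᵥ v‖ + ‖z‖ * ‖x‖ := by
      rw [← norm_smul, ← norm_smul, ← hv]
      exact norm_add_le _ _
    linarith [hA v]
  have hμ' : b * ‖x‖ < (‖μ‖ - a) * ‖c‖ := by
    rw [← div_lt_iff₀ hc]
    linarith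
  have hpos : 0 ≤ ‖μ‖ - a := by
    have : 0 ≤ b * ‖x‖ / ‖c‖ := by positivity
    linarith
  by_contra hne
  have hzp := norm_pos_iff.2 hne
  have h3 := mul_le_mul_of_nonneg_left hz1 hpos
  have h4 := mul_le_mul_of_nonneg_left hz2 hb
  nlinarith [mul_lt_mul_of_pos_left hμ' hzp]

theorem ObservableOn.transferNonvanishing {S : Set n} {A : Matrix n n ℂ} {C : Matrix m n ℂ}
    (h : ObservableOn S A C) (hA : ∀ i j, i ∉ S → A i j = 0) {a : n} (ha : a ∈ S) :
    TransferNonvanishing A C (Pi.single a 1) 0 := by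
  refine transferNonvanishing_of_markov ?_
  by_contra! hk
  have := h.eq_zero hA (v := Pi.single a 1) (fun i hi => by
    rw [Pi.single_eq_of_ne (by rintro rfl; exact hi ha)]) hk
  simpa using congrFun this a

/-- `A` and `C` are matrices with real entries, supported on the states in `S` and the edges
given by `E` (state to state) and `F` (state to output), that are observable on `S`. -/
structure IsRealization (E : n → n → Prop) (F : n → m → Prop) (S : Set n)
    (A : Matrix n n ℂ) (C : Matrix m n ℂ) : Prop where
  im_state : ∀ i j, (A i j).im = 0
  im_output : ∀ p i, (C p i).im = 0
  state : ∀ i j, A i j ≠ 0 → E j i ∧ i ∈ S ∧ j ∈ S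
  output : ∀ p i, C p i ≠ 0 → F i p ∧ i ∈ S
  observable : ObservableOn S A C

open Classical in
/-- The adjacency matrix of the functional graph of `σ` on `T`. -/
noncomputable def functionalMatrix {n : Type*} (σ : n → n) (T : Set n) : Matrix n n ℂ :=
  Matrix.of fun i j => if j ∈ T ∧ σ j = i then 1 else 0

omit [DecidableEq n] in
theorem functionalMatrix_mulVec_apply {σ : n → n} {T : Set n} (hσ : Set.InjOn σ T)
    (v : n → ℂ) {j : n} (hj : j ∈ T) : (functionalMatrix σ T *ᵥ v) (σ j) = v j := by
  rw [mulVec, dotProduct, Finset.sum_eq_single j]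
  · simp [functionalMatrix, hj]
  · intro i _ hij
    have : ¬ (i ∈ T ∧ σ i = σ j) := fun h => hij (hσ h.1 hj h.2)
    simp [functionalMatrix, this]
  · simp

omit [DecidableEq n] in
theorem functionalMatrix_mulVec_apply_of_notMem {σ : n → n} {T : Set n} (hσ : Set.MapsTo σ T T)
    (v : n → ℂ) {i : n} (hi : i ∉ T) : (functionalMatrix σ T *ᵥ v) i = 0 := by
  refine Finset.sum_eq_zero fun j _ => ?_
  have : ¬ (j ∈ T ∧ σ j = i) := by
    rintro ⟨hj, rfl⟩
    exact hi (hσ hj)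
  simp [functionalMatrix, this]

omit [Fintype m] in
/-- A realization extends over a disjoint cycle attached to it through the vertex `b`: put a
sufficiently large weight on the edges of the cycle. -/
theorem IsRealization.union_cycle {E : n → n → Prop} {F : n → m → Prop} {S T : Set n}
    {A : Matrix n n ℂ} {C : Matrix m n ℂ} (h : IsRealization E F S A C)
    (hST : Disjoint S T) {σ : n → n} (hσ : Set.BijOn σ T T) {b : n} (hb : b ∈ T)
    (hT : ∀ i ∈ T, ∃ k, σ^[k] b = i) (hE : ∀ i ∈ T, E i (σ i))
    {x : n → ℂ} {y : m → ℂ} (hxim : ∀ i, (x i).im = 0) (hyim : ∀ p, (y p).im = 0)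
    (hx : ∀ i, x i ≠ 0 → E b i ∧ i ∈ S) (hy : ∀ p, y p ≠ 0 → F b p)
    (hxy : TransferNonvanishing A C x y) :
    ∃ A' C', IsRealization E F (S ∪ T) A' C' := by
  classical
  obtain ⟨W, hW⟩ := hxy
  set w : ℝ := max W 0 + 1 with hw
  have hWw : W < w := by linarith [le_max_left W 0]
  have hw0 : 0 < w := by linarith [le_max_right W 0]
  refine ⟨A + (w : ℂ) • functionalMatrix σ T + vecMulVec x (Pi.single b 1),
    C + vecMulVec y (Pi.single b 1), ?_, ?_, ?_, ?_, ?_⟩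
  · intro i j
    simp only [Matrix.add_apply, Matrix.smul_apply, functionalMatrix, of_apply, vecMulVec_apply,
      Pi.single_apply]
    split_ifs <;> simp [h.im_state, hxim]
  · intro p i
    simp only [Matrix.add_apply, vecMulVec_apply, Pi.single_apply]
    split_ifs <;> simp [h.im_output, hyim]
  · intro i j hij
    by_cases h1 : A i j ≠ 0
    · have := h.state i j h1
      exact ⟨this.1, Or.inl this.2.1, Or.inl this.2.2⟩
    by_cases h2 : j ∈ T ∧ σ j = i
    · obtain ⟨hj, rfl⟩ := h2
      exact ⟨hE j hj, Or.inr (hσ.mapsTo hj), Or.inr hj⟩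
    by_cases h3 : j = b
    · subst h3
      have hxi : x i ≠ 0 := by
        rintro h0
        simp_all [functionalMatrix, vecMulVec_apply]
      exact ⟨(hx i hxi).1, Or.inl (hx i hxi).2, Or.inr hb⟩
    · simp_all [functionalMatrix, vecMulVec_apply]
  · intro p i hpi
    by_cases h1 : C p i ≠ 0
    · exact ⟨(h.output p i h1).1, Or.inl (h.output p i h1).2⟩
    by_cases h3 : i = b
    · subst h3
      exact ⟨hy p (by rintro h0; simp_all [vecMulVec_apply]), Or.inr hb⟩
    · simp_all [vecMulVec_apply]
  · intro μ v hv hCv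
    rw [add_mulVec, vecMulVec_single_one_mulVec] at hCv
    simp only [add_mulVec, vecMulVec_single_one_mulVec, smul_mulVec, Pi.add_apply, Pi.smul_apply, smul_eq_mul] at hv
    have hS : ∀ i ∈ S, (A *ᵥ v) i + v b * x i = μ * v i := by
      intro i hi
      rw [← hv i (Or.inl hi), functionalMatrix_mulVec_apply_of_notMem hσ.mapsTo _
        (Set.disjoint_left.1 hST hi)]
      ring
    have hA0 : ∀ i j, i ∉ S → A i j = 0 := fun i j hi => by
      by_contra h0
      exact hi (h.state i j h0).2.1
    have hA1 : ∀ i j, j ∉ S → A i j = 0 := fun i j hj => by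
      by_contra h0
      exact hj (h.state i j h0).2.2
    have hC1 : ∀ p j, j ∉ S → C p j = 0 := fun p j hj => by
      by_contra h0
      exact hj (h.output p j h0).2
    have hx0 : ∀ i ∉ S, x i = 0 := fun i hi => by
      by_contra h0
      exact hi (hx i h0).2
    have hAv0 : ∀ i ∉ S, (A *ᵥ v) i = 0 := fun i hi => by
      simp [mulVec, dotProduct, hA0 i _ hi]
    have hcyc : ∀ j ∈ T, w * v j = μ * v (σ j) := by
      intro j hj
      have hjS := Set.disjoint_right.1 hST (hσ.mapsTo hj)
      rw [← hv (σ j) (Or.inr (hσ.mapsTo hj)), functionalMatrix_mulVec_apply hσ.injOn _ hj,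
        hAv0 _ hjS, hx0 _ hjS]
      ring
    have hT0 : ∀ j ∈ T, v j = 0 := by
      by_cases hμ : ‖μ‖ = w
      · have hμ0 : μ ≠ 0 := norm_pos_iff.1 (hμ ▸ hw0)
        have hvb : v b = 0 := by
          refine hW μ (hμ ▸ hWw) (S.indicator v) (v b) (funext fun i => ?_) ?_
          · rw [mulVec_indicator hA1]
            by_cases hi : i ∈ S
            · simpa [hi] using hS i hi
            · simp [hi, hAv0, hx0]
          · rwa [mulVec_indicator hC1]
        have hiter : ∀ k, σ^[k] b ∈ T ∧ v (σ^[k] b) = 0 := by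
          intro k
          induction k with
          | zero => exact ⟨hb, hvb⟩
          | succ k ih =>
            rw [Function.iterate_succ_apply']
            refine ⟨hσ.mapsTo ih.1, ?_⟩
            have := hcyc _ ih.1
            rw [ih.2, mul_zero] at this
            exact (mul_eq_zero.1 this.symm).resolve_left hμ0
        intro j hj
        obtain ⟨k, rfl⟩ := hT j hj
        exact (hiter k).2
      · have hsum : ∑ j ∈ T.toFinset, ‖v (σ j)‖ = ∑ j ∈ T.toFinset, ‖v j‖ := by
          refine Finset.sum_bij (fun j _ => σ j) ?_ ?_ ?_ fun _ _ => rfl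
          · intro j hj
            simpa using hσ.mapsTo (by simpa using hj)
          · intro j hj k hk hjk
            exact hσ.injOn (by simpa using hj) (by simpa using hk) hjk
          · intro j hj
            obtain ⟨k, hk, rfl⟩ := hσ.surjOn (by simpa using hj : j ∈ T)
            exact ⟨k, by simpa using hk, rfl⟩
        have hnorm : w * ∑ j ∈ T.toFinset, ‖v j‖ = ‖μ‖ * ∑ j ∈ T.toFinset, ‖v j‖ := by
          rw [Finset.mul_sum, ← hsum, Finset.mul_sum]
          refine Finset.sum_congr rfl fun j hj => ?_
          have := congrArg norm (hcyc j (by simpa using hj))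
          rwa [norm_mul, norm_mul, Complex.norm_real, Real.norm_of_nonneg hw0.le] at this
        have h0 : ∑ j ∈ T.toFinset, ‖v j‖ = 0 := by
          by_contra hne
          exact hμ (mul_right_cancel₀ hne hnorm).symm
        intro j hj
        rw [Finset.sum_eq_zero_iff_of_nonneg fun _ _ => norm_nonneg _] at h0
        exact norm_eq_zero.1 (h0 j (by simpa using hj))
    have hvb := hT0 b hb
    have hS0 := h.observable μ v (fun i hi => by simpa [hvb] using hS i hi)
      (by simpa [hvb] using hCv)
    rintro i (hi | hi)
    · exact hS0 i hi
    · exact hT0 i hi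

/-- The states from which following `g` leads to an output. -/
inductive LeadsToOutput {n m : Type*} (g : n → n ⊕ m) : n → Prop
  | output {i : n} {p : m} (h : g i = Sum.inr p) : LeadsToOutput g i
  | step {i j : n} (h : g i = Sum.inl j) (hj : LeadsToOutput g j) : LeadsToOutput g i

omit [Fintype m] [DecidableEq n] in
/-- Output-topped paths are observable with unit weights. -/
theorem exists_isRealization_leadsToOutput {E : n → n → Prop} {F : n → m → Prop}
    {g : n → n ⊕ m} (hg : Function.Injective g) (hE : ∀ i j, g i = Sum.inl j → E i j)
    (hF : ∀ i p, g i = Sum.inr p → F i p) :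
    ∃ A C, IsRealization E F {i | LeadsToOutput g i} A C := by
  classical
  refine ⟨Matrix.of fun i j => if LeadsToOutput g j ∧ g j = Sum.inl i then 1 else 0,
    Matrix.of fun p i => if g i = Sum.inr p then 1 else 0, ?_, ?_, ?_, ?_, ?_⟩
  · intro i j
    simp only [of_apply]
    split_ifs <;> simp
  · intro i j
    simp only [of_apply]
    split_ifs <;> simp
  · intro i j hij
    obtain ⟨hj, hji⟩ : LeadsToOutput g j ∧ g j = Sum.inl i := by
      by_contra h
      simp [h] at hij
    refine ⟨hE j i hji, ?_, hj⟩
    cases hj with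
    | output h => simp [h] at hji
    | step h hk =>
      obtain rfl := Sum.inl_injective (h.symm.trans hji)
      exact hk
  · intro p i hpi
    have h : g i = Sum.inr p := by
      by_contra h
      simp [h] at hpi
    exact ⟨hF i p h, .output h⟩
  · intro μ v hv hCv i hi
    induction hi with
    | @output i p h =>
      have := congrFun hCv p
      rw [mulVec, dotProduct, Finset.sum_eq_single i] at this
      · simpa [h] using this
      · intro j _ hj
        have : g j ≠ Sum.inr p := fun h' => hj (hg (h'.trans h.symm))
        simp [this]
      · simp
    | @step i j h hj ih =>
      have := hv j hj
      rw [ih, mul_zero, mulVec, dotProduct, Finset.sum_eq_single i] at this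
      · simpa [h, LeadsToOutput.step h hj] using this
      · intro k _ hk
        have : g k ≠ Sum.inl j := fun h' => hk (hg (h'.trans h.symm))
        simp [this]
      · simp

theorem exists_isRealization_univ {E : n → n → Prop} {F : n → m → Prop}
    (hreach : ∀ i, ∃ j p, Relation.ReflTransGen E i j ∧ F j p)
    {g : n → n ⊕ m} (hg : Function.Injective g) (hE : ∀ i j, g i = Sum.inl j → E i j)
    (hF : ∀ i p, g i = Sum.inr p → F i p) :
    ∃ A C, IsRealization E F Set.univ A C := by
  classical
  let Q : Set (Set n) := {S | {i | LeadsToOutput g i} ⊆ S ∧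
    (∀ i j, g i = Sum.inl j → j ∈ S → i ∈ S) ∧ ∃ A C, IsRealization E F S A C}
  have hbase : {i | LeadsToOutput g i} ∈ Q :=
    ⟨subset_rfl, fun i j h hj => LeadsToOutput.step h hj, exists_isRealization_leadsToOutput hg hE hF⟩
  obtain ⟨S, -, hSmax⟩ := (Set.toFinite Q).exists_le_maximal hbase
  obtain ⟨hS, hback, A, C, hAC⟩ := hSmax.prop
  suffices S = Set.univ from ⟨A, C, this ▸ hAC⟩
  by_contra hne
  obtain ⟨i₀, hi₀⟩ := (Set.ne_univ_iff_exists_notMem S).1 hne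
  obtain ⟨b, hbS, hb⟩ : ∃ b ∉ S, (∃ a ∈ S, E b a) ∨ ∃ p, F b p := by
    obtain ⟨j, p, hij, hjp⟩ := hreach i₀
    induction hij using Relation.ReflTransGen.head_induction_on with
    | refl => exact ⟨j, hi₀, Or.inr ⟨p, hjp⟩⟩
    | @head a c hac _ ih =>
      by_cases hc : c ∈ S
      · exact ⟨a, hi₀, Or.inl ⟨c, hc, hac⟩⟩
      · exact ih hc
  let σ : n → n := fun i => Sum.elim id (fun _ => i) (g i)
  have hσ : ∀ i ∉ S, g i = Sum.inl (σ i) := by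
    intro i hi
    rcases hgi : g i with j | p
    · simp [σ, hgi]
    · exact absurd (hS (LeadsToOutput.output hgi)) hi
  let T : Set n := Set.range fun k => σ^[k] b
  have hTS : ∀ i ∈ T, i ∉ S := by
    rintro _ ⟨k, rfl⟩
    induction k with
    | zero => exact hbS
    | succ k ih =>
      simp only [Function.iterate_succ_apply']
      exact fun h => ih (hback _ _ (hσ _ ih) h)
  have hbT : b ∈ T := ⟨0, rfl⟩
  have hmaps : Set.MapsTo σ T T := by
    rintro _ ⟨k, rfl⟩
    exact ⟨k + 1, by simp only [Function.iterate_succ_apply']⟩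
  have hinj : Set.InjOn σ T := by
    intro i hi j hj hij
    apply hg
    rw [hσ i (hTS i hi), hσ j (hTS j hj), hij]
  have hbij : Set.BijOn σ T T := by
    refine ⟨hmaps, hinj, ?_⟩
    exact (Set.eq_of_subset_of_ncard_le hmaps.image_subset hinj.ncard_image.ge).ge
  have hdisj : Disjoint S T := Set.disjoint_right.2 fun {i} hi => hTS i hi
  have hunion : ∃ A' C', IsRealization E F (S ∪ T) A' C' := by
    have hET : ∀ i ∈ T, E i (σ i) := fun i hi => hE i _ (hσ i (hTS i hi))
    rcases hb with ⟨a, ha, hba⟩ | ⟨p, hbp⟩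
    · refine hAC.union_cycle hdisj hbij hbT (fun i hi => hi) hET
        (x := Pi.single a 1) (y := 0) (fun i => ?_) (by simp) (fun i hi => ?_) (by simp)
        (hAC.observable.transferNonvanishing (fun i j hi => ?_) ha)
      · rw [Pi.single_apply]
        split_ifs <;> simp
      · obtain rfl : i = a := by
          by_contra h
          simp [h] at hi
        exact ⟨hba, ha⟩
      · by_contra h0
        exact hi (hAC.state i j h0).2.1
    · refine hAC.union_cycle hdisj hbij hbT (fun i hi => hi) hET
        (x := 0) (y := Pi.single p 1) (by simp) (fun q => ?_) (by simp) (fun q hq => ?_)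
        (transferNonvanishing_of_output A C (by simp))
      · rw [Pi.single_apply]
        split_ifs <;> simp
      · obtain rfl : q = p := by
          by_contra h
          simp [h] at hq
        exact hbp
  have hmem : S ∪ T ∈ Q := by
    refine ⟨hS.trans Set.subset_union_left, ?_, hunion⟩
    rintro i j hij (hj | hj)
    · exact Or.inl (hback i j hij hj)
    · obtain ⟨k, hk, rfl⟩ := hbij.surjOn hj
      right
      rwa [hg (hij.trans (hσ k (hTS k hk)).symm)]
  exact hbS (hSmax.le_of_ge hmem Set.subset_union_left (Or.inr hbT))

/-- The observability matrix of `(A, C)`, with the blocks `C * A ^ k` for `k < N`. -/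
def observabilityMatrix (N : ℕ) (A : Matrix n n ℝ) (C : Matrix m n ℝ) :
    Matrix (Fin N × m) n ℝ :=
  Matrix.of fun q j => (C * A ^ (q.1 : ℕ)) q.2 j

omit [Fintype m] in
theorem observabilityMatrix_mulVec_eq_zero_iff {N : ℕ} {A : Matrix n n ℝ} {C : Matrix m n ℝ}
    {v : n → ℝ} :
    observabilityMatrix N A C *ᵥ v = 0 ↔ ∀ k < N, (C * A ^ k) *ᵥ v = 0 := by
  constructor
  · intro h k hk
    funext p
    exact congrFun h (⟨k, hk⟩, p)
  · intro h
    funext q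
    exact congrFun (h q.1 q.1.2) q.2

/-- Observability persists under a suitable perturbation making all allowed entries nonzero. -/
theorem exists_exact_support {N : ℕ} {E : n → n → Prop} {F : n → m → Prop}
    {A : Matrix n n ℝ} {C : Matrix m n ℝ} (hA : ∀ i j, A i j ≠ 0 → E j i)
    (hC : ∀ p i, C p i ≠ 0 → F i p)
    (h : (observabilityMatrix N A C).rank = Fintype.card n) :
    ∃ (A' : Matrix n n ℝ) (C' : Matrix m n ℝ), (∀ i j, A' i j ≠ 0 ↔ E j i) ∧
      (∀ p i, C' p i ≠ 0 ↔ F i p) ∧ (observabilityMatrix N A' C').rank = Fintype.card n := by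
  classical
  let A' : ℝ → Matrix n n ℝ := fun t => A + t • Matrix.of fun i j => if E j i then 1 else 0
  let C' : ℝ → Matrix m n ℝ := fun t => C + t • Matrix.of fun p i => if F i p then 1 else 0
  have hrank : ∀ M : Matrix (Fin N × m) n ℝ, M.rank = Fintype.card n ↔ (Mᵀ * M).det ≠ 0 := by
    intro M
    rw [← rank_transpose_mul_self, rank_eq_card_iff, ne_eq, ← exists_mulVec_eq_zero_iff]
    push Not
    exact forall_congr' fun v => by tauto
  have hentry : ∀ a : ℝ, ∀ᶠ t in 𝓝[≠] (0 : ℝ), a + t ≠ 0 := by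
    intro a
    by_cases ha : a = 0
    · simpa [ha] using eventually_mem_nhdsWithin (a := (0 : ℝ)) (s := {0}ᶜ)
    · have : ContinuousAt (fun t : ℝ => a + t) 0 := by fun_prop
      exact (this.eventually_ne (by simpa using ha)).filter_mono nhdsWithin_le_nhds
  have hAcont : Continuous A' := by fun_prop
  have hCcont : Continuous C' := by fun_prop
  have hO : Continuous fun t => observabilityMatrix N (A' t) (C' t) := by
    refine continuous_matrix fun q j => ?_
    exact (hCcont.matrix_mul (hAcont.pow _)).matrix_elem q.2 j
  have hdet : ∀ᶠ t in 𝓝[≠] (0 : ℝ), (observabilityMatrix N (A' t) (C' t)).rank =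
      Fintype.card n := by
    simp only [hrank]
    have hcont := (hO.matrix_transpose.matrix_mul hO).matrix_det
    refine (hcont.continuousAt.eventually_ne ?_).filter_mono nhdsWithin_le_nhds
    rw [← hrank]
    simpa [A', C'] using h
  have hAe : ∀ᶠ t in 𝓝[≠] (0 : ℝ), ∀ i j, A i j + t ≠ 0 := by
    simp only [eventually_all]
    exact fun i j => hentry _
  have hCe : ∀ᶠ t in 𝓝[≠] (0 : ℝ), ∀ p i, C p i + t ≠ 0 := by
    simp only [eventually_all]
    exact fun p i => hentry _
  obtain ⟨t, ht, htA, htC⟩ := (hdet.and (hAe.and hCe)).exists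
  refine ⟨A' t, C' t, fun i j => ?_, fun p i => ?_, ht⟩
  · by_cases hE : E j i
    · simpa [A', hE] using htA i j
    · simpa [A', hE] using fun h0 => hE (hA i j h0)
  · by_cases hF : F i p
    · simpa [C', hF] using htC p i
    · simpa [C', hF] using fun h0 => hF (hC p i h0)

omit [Fintype m] in
/-- The real parts of a realization on all states have a full rank observability matrix. -/
theorem IsRealization.rank_observabilityMatrix {E : n → n → Prop} {F : n → m → Prop}
    {A : Matrix n n ℂ} {C : Matrix m n ℂ} (h : IsRealization E F Set.univ A C) :
    (observabilityMatrix (Fintype.card n) (A.map Complex.re) (C.map Complex.re)).rank =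
      Fintype.card n := by
  rw [rank_eq_card_iff]
  intro v hv
  rw [observabilityMatrix_mulVec_eq_zero_iff] at hv
  have hv' := mul_pow_mulVec_eq_zero _ _ _ hv
  have hA : (A.map Complex.re).map Complex.ofRealHom = A := by
    ext i j
    exact Complex.ext (by simp) (by simp [h.im_state])
  have hC : (C.map Complex.re).map Complex.ofRealHom = C := by
    ext i j
    exact Complex.ext (by simp) (by simp [h.im_output])
  have hz : Complex.ofRealHom ∘ v = 0 := by
    refine h.observable.eq_zero (by simp) (by simp) fun k => ?_
    rw [← hA, ← hC, ← Matrix.map_pow, ← Matrix.map_mul]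
    funext p
    have := RingHom.map_mulVec Complex.ofRealHom
      (C.map Complex.re * A.map Complex.re ^ k) v p
    rw [hv' k] at this
    exact this.symm.trans (by simp)
  funext i
  simpa using congrFun hz i

omit [Fintype m] in
theorem reaches_output_of_rank {N : ℕ} {E : n → n → Prop} {F : n → m → Prop}
    {A : Matrix n n ℝ} {C : Matrix m n ℝ} (hA : ∀ i j, A i j ≠ 0 → E j i)
    (hC : ∀ p i, C p i ≠ 0 → F i p)
    (h : (observabilityMatrix N A C).rank = Fintype.card n) (i : n) :
    ∃ j p, Relation.ReflTransGen E i j ∧ F j p := by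
  by_contra! hi
  rw [rank_eq_card_iff] at h
  have hsupp : ∀ k j, ((A ^ k) *ᵥ Pi.single i 1) j ≠ 0 → Relation.ReflTransGen E i j := by
    intro k
    induction k with
    | zero =>
      intro j hj
      obtain rfl : j = i := by
        by_contra hne
        simp [hne] at hj
      exact .refl
    | succ k ih =>
      intro j hj
      rw [pow_succ', ← mulVec_mulVec] at hj
      obtain ⟨l, -, hl⟩ := Finset.exists_ne_zero_of_sum_ne_zero hj
      exact (ih l (right_ne_zero_of_mul hl)).tail (hA j l (left_ne_zero_of_mul hl))
  have h0 := h (Pi.single i 1) (observabilityMatrix_mulVec_eq_zero_iff.2 fun k _ => by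
    rw [← mulVec_mulVec]
    funext p
    refine Finset.sum_eq_zero fun j _ => ?_
    by_contra hne
    exact hi j p (hsupp k j (right_ne_zero_of_mul hne)) (hC p j (left_ne_zero_of_mul hne)))
  simpa using congrFun h0 i

theorem exists_injective_of_rank {N : ℕ} {A : Matrix n n ℝ} {C : Matrix m n ℝ}
    (h : (observabilityMatrix N A C).rank = Fintype.card n) :
    ∃ g : n → n ⊕ m, Function.Injective g ∧
      ∀ i, (∀ j, g i = Sum.inl j → A j i ≠ 0) ∧ (∀ p, g i = Sum.inr p → C p i ≠ 0) := by
  rw [rank_eq_card_iff] at h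
  obtain ⟨g, hg, hne⟩ := exists_injective_of_ker_eq_bot (fromRows A C) fun v hv => by
    rw [fromRows_mulVec] at hv
    have hAv : A *ᵥ v = 0 := funext fun i => congrFun hv (Sum.inl i)
    have hCv : C *ᵥ v = 0 := funext fun p => congrFun hv (Sum.inr p)
    refine h v (observabilityMatrix_mulVec_eq_zero_iff.2 fun k _ => ?_)
    cases k with
    | zero => simpa using hCv
    | succ k => rw [← mulVec_mulVec, pow_succ, ← mulVec_mulVec, hAv, mulVec_zero, mulVec_zero]
  refine ⟨g, hg, fun i => ⟨fun j hj => ?_, fun p hp => ?_⟩⟩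
  · simpa [hj] using hne i
  · simpa [hp] using hne i

end StructuralObservability

open StructuralObservability

/-- Structural observability of linear systems (dual of Lin's theorem).
`𝒜` is the set of state-to-state edges ((j,i) means j → i), `𝒞` the set of
state-to-output edges ((i,p) means state i → output p). -/
theorem structural_observability
    (N P : ℕ) (hN : 0 < N) (hP : 0 < P)
    (𝒜 : Set (Fin N × Fin N)) (𝒞 : Set (Fin N × Fin P)) :
    (∃ (A : Matrix (Fin N) (Fin N) ℝ) (C : Matrix (Fin P) (Fin N) ℝ),
      (∀ i j, A i j ≠ 0 ↔ (j, i) ∈ 𝒜) ∧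
      (∀ p i, C p i ≠ 0 ↔ (i, p) ∈ 𝒞) ∧
      Matrix.rank (Matrix.of fun (q : Fin N × Fin P) (j : Fin N) =>
        (C * A ^ (q.1 : ℕ)) q.2 j) = N)
    ↔
    ((∀ i : Fin N, ∃ (j₀ : Fin N) (p : Fin P),
        Relation.ReflTransGen (fun a b => (a, b) ∈ 𝒜) i j₀ ∧ (j₀, p) ∈ 𝒞) ∧
     (∃ g : Fin N → (Fin N ⊕ Fin P), Function.Injective g ∧
        ∀ i : Fin N,
          (∀ j : Fin N, g i = Sum.inl j → (i, j) ∈ 𝒜) ∧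
          (∀ p : Fin P, g i = Sum.inr p → (i, p) ∈ 𝒞))) := by
  constructor
  · rintro ⟨A, C, hA, hC, hrank⟩
    have h : (observabilityMatrix N A C).rank = Fintype.card (Fin N) := by
      rw [Fintype.card_fin]
      exact hrank
    refine ⟨reaches_output_of_rank (E := fun a b => (a, b) ∈ 𝒜) (F := fun i p => (i, p) ∈ 𝒞)
      (fun i j => (hA i j).1) (fun p i => (hC p i).1) h, ?_⟩
    obtain ⟨g, hg, hgs⟩ := exists_injective_of_rank h
    exact ⟨g, hg, fun i => ⟨fun j hj => (hA j i).1 ((hgs i).1 j hj),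
      fun p hp => (hC p i).1 ((hgs i).2 p hp)⟩⟩
  · rintro ⟨hreach, g, hg, hgs⟩
    obtain ⟨A, C, hAC⟩ := exists_isRealization_univ (E := fun a b => (a, b) ∈ 𝒜)
      (F := fun i p => (i, p) ∈ 𝒞) hreach hg (fun i => (hgs i).1) (fun i => (hgs i).2)
    obtain ⟨A', C', hA', hC', hrank⟩ := exists_exact_support
      (fun i j h => (hAC.state i j fun h0 => h (by simp [h0])).1)
      (fun p i h => (hAC.output p i fun h0 => h (by simp [h0])).1) hAC.rank_observabilityMatrix
    refine ⟨A', C', hA', hC', ?_⟩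
    rw [Fintype.card_fin] at hrank
    exact hrank
end

section
/- Let X and U be finite types, let V = X ⊕ U, and let E : V → V → Prop be an edge relation. Suppose that every state node is reachable from some input node: for every x ∈ X there exists u ∈ U with Relation.ReflTransGen E (Sum.inr u) (Sum.inl x). Then there exists a parent function p : X → V such that (i) for every x ∈ X, E (p x) (Sum.inl x) holds (each state node keeps exactly one incoming edge of the original graph), and (ii) for every x ∈ X there exists k ∈ ℕ such that iterating the map q : V → V defined by q (Sum.inl x) = p x and q (Sum.inr u) = Sum.inr u, k times starting from Sum.inl x, lands in the image of Sum.inr (repeatedly following parents from any state node reaches an input node in finitely many steps). In other words, the graph contains a spanning subgraph that is a disjoint union of directed trees rooted at input nodes in which every state node has exactly one incoming edge. -/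
/-- If every vertex is reachable from `S`, there is a rank function (the distance from `S`)
such that each vertex outside `S` has an in-neighbour of smaller rank. -/
theorem exists_rank_of_forall_reachable {V : Type*} (E : V → V → Prop) (S : Set V)
    (h : ∀ v, ∃ s ∈ S, Relation.ReflTransGen E s v) :
    ∃ d : V → ℕ, ∀ v ∉ S, ∃ w, E w v ∧ d w < d v := by
  classical
  let L : ℕ → Set V := fun n => (fun T : Set V => {v | ∃ w ∈ T, E w v})^[n] S
  have hsucc : ∀ n v, v ∈ L (n + 1) ↔ ∃ w ∈ L n, E w v := fun n v => by
    simp only [L, Function.iterate_succ_apply', Set.mem_ofPred_eq]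
  have hL : ∀ v, ∃ n, v ∈ L n := by
    intro v
    obtain ⟨s, hs, hsv⟩ := h v
    induction hsv with
    | refl => exact ⟨0, hs⟩
    | tail _ hE ih =>
      obtain ⟨n, hn⟩ := ih
      exact ⟨n + 1, (hsucc n _).2 ⟨_, hn, hE⟩⟩
  refine ⟨fun v => Nat.find (hL v), fun v hv => ?_⟩
  have hmem := Nat.find_spec (hL v)
  rcases hd : Nat.find (hL v) with _ | n
  · rw [hd] at hmem
    exact absurd hmem hv
  · rw [hd, hsucc] at hmem
    obtain ⟨w, hw, hE⟩ := hmem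
    exact ⟨w, hE, by simpa only [hd] using Nat.lt_succ_of_le (Nat.find_min' (hL w) hw)⟩

/-- Iterating a map that lowers a rank outside `S` eventually reaches `S`. -/
theorem exists_iterate_mem_of_rank_lt {V : Type*} (q : V → V) (S : Set V) (d : V → ℕ)
    (hq : ∀ v ∉ S, d (q v) < d v) (v : V) : ∃ k : ℕ, q^[k] v ∈ S := by
  induction hn : d v using Nat.strong_induction_on generalizing v with
  | _ n ih =>
    by_cases hv : v ∈ S
    · exact ⟨0, hv⟩
    · obtain ⟨k, hk⟩ := ih _ (hn ▸ hq v hv) (q v) rfl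
      exact ⟨k + 1, hk⟩

/-- If every state node (in `X`) is reachable from some input node (in `U`),
then the graph has a spanning subgraph that is a disjoint union of directed
trees rooted at input nodes, in which every state node has exactly one
incoming edge: a parent function `p` picking one incoming edge per state node
such that repeatedly following parents reaches an input node. -/
theorem spanning_input_rooted_trees
    {X U : Type*} [Finite X] [Finite U]
    (E : (X ⊕ U) → (X ⊕ U) → Prop)
    (h : ∀ x : X, ∃ u : U, Relation.ReflTransGen E (Sum.inr u) (Sum.inl x)) :
    ∃ p : X → (X ⊕ U),
      (∀ x : X, E (p x) (Sum.inl x)) ∧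
      (∀ x : X, ∃ k : ℕ,
        (Sum.elim p (fun u : U => Sum.inr u))^[k] (Sum.inl x)
          ∈ Set.range (Sum.inr : U → X ⊕ U)) := by
  have hreach : ∀ v : X ⊕ U, ∃ s ∈ Set.range (Sum.inr : U → X ⊕ U),
      Relation.ReflTransGen E s v := by
    rintro (x | u)
    · obtain ⟨u, hu⟩ := h x
      exact ⟨_, ⟨u, rfl⟩, hu⟩
    · exact ⟨_, ⟨u, rfl⟩, .refl⟩
  obtain ⟨d, hd⟩ := exists_rank_of_forall_reachable E _ hreach
  choose p hE hlt using fun x : X => hd (Sum.inl x) (by simp)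
  refine ⟨p, hE, fun x => exists_iterate_mem_of_rank_lt _ _ d ?_ _⟩
  rintro (y | u) hv
  · exact hlt y
  · exact absurd ⟨u, rfl⟩ hv
end

section
/- Let V be a finite type and E : V → V → Prop an edge relation, with reachability reach = Relation.ReflTransGen E. Call a vertex v a root vertex if every vertex that reaches v is also reached by v (for all w, reach w v implies reach v w); the strongly connected component of v is SCC(v) = {w | reach v w ∧ reach w v}. Then for any set D ⊆ V, the following are equivalent: (1) every vertex of V is reachable from some element of D; (2) for every root vertex v, D intersects SCC(v), i.e. there exists d ∈ D with reach d v and reach v d. -/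
/-- In a finite digraph, every vertex is reachable from a root vertex. -/
theorem exists_root_reflTransGen {V : Type*} [Finite V] (E : V → V → Prop) (v : V) :
    ∃ r : V, Relation.ReflTransGen E r v ∧
      ∀ w : V, Relation.ReflTransGen E w r → Relation.ReflTransGen E r w := by
  let _ : Preorder V :=
    { le := Relation.ReflTransGen E
      le_refl := fun _ => .refl
      le_trans := fun _ _ _ => .trans }
  obtain ⟨r, hrv, hr⟩ := (Set.toFinite (Set.univ : Set V)).exists_le_minimal (Set.mem_univ v)
  exact ⟨r, hrv, fun w hw => hr.2 (Set.mem_univ w) hw⟩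

/-- A set `D` of driver nodes reaches every vertex of a finite digraph iff
`D` intersects the strongly connected component of every root vertex. -/
theorem driver_set_iff_meets_root_SCCs
    {V : Type*} [Finite V] (E : V → V → Prop) (D : Set V) :
    (∀ v : V, ∃ d ∈ D, Relation.ReflTransGen E d v)
    ↔
    (∀ v : V,
      (∀ w : V, Relation.ReflTransGen E w v → Relation.ReflTransGen E v w) →
      ∃ d ∈ D, Relation.ReflTransGen E d v ∧ Relation.ReflTransGen E v d) := by
  constructor
  · intro h v hv
    obtain ⟨d, hd, hdv⟩ := h v
    exact ⟨d, hd, hdv, hv d hdv⟩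
  · intro h v
    obtain ⟨r, hrv, hr⟩ := exists_root_reflTransGen E v
    obtain ⟨d, hd, hdr, -⟩ := h r hr
    exact ⟨d, hd, hdr.trans hrv⟩
end

section
/- Let V be a finite type and E : V → V → Prop an edge relation, with reachability reach = Relation.ReflTransGen E. Call a vertex v a root vertex if for all w, reach w v implies reach v w, and let SCC(v) = {w | reach v w ∧ reach w v}. Then the minimum cardinality of a set D ⊆ V such that every vertex of V is reachable from some element of D equals the number of root strongly connected components of the graph, i.e. the cardinality of the finite set of sets {SCC(v) | v is a root vertex}. -/
namespace RelationReachability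

open Relation

variable {V : Type*}

/-- The strongly connected component of `v` in the digraph with edge relation `E`. -/
def scc (E : V → V → Prop) (v : V) : Set V :=
  {w | ReflTransGen E v w ∧ ReflTransGen E w v}

/-- A root vertex reaches every vertex from which it is reachable. -/
def IsRoot (E : V → V → Prop) (v : V) : Prop :=
  ∀ w, ReflTransGen E w v → ReflTransGen E v w

theorem mem_scc_self (E : V → V → Prop) (v : V) : v ∈ scc E v :=
  ⟨.refl, .refl⟩

theorem scc_eq_of_mem {E : V → V → Prop} {v w : V} (h : w ∈ scc E v) : scc E w = scc E v :=
  Set.ext fun _ => ⟨fun hx => ⟨h.1.trans hx.1, hx.2.trans h.2⟩,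
    fun hx => ⟨h.2.trans hx.1, hx.2.trans h.1⟩⟩

theorem exists_isRoot_reflTransGen [Finite V] (E : V → V → Prop) (v : V) :
    ∃ u, IsRoot E u ∧ ReflTransGen E u v := by
  let _ : Preorder V :=
    { le := ReflTransGen E
      le_refl := fun _ => .refl
      le_trans := fun _ _ _ => ReflTransGen.trans }
  obtain ⟨u, huv, hu⟩ := (Set.toFinite (Set.univ : Set V)).exists_le_minimal (Set.mem_univ v)
  exact ⟨u, fun w hw => hu.2 (Set.mem_univ w) hw, huv⟩

/-- A set from which every vertex is reachable meets each root component. -/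
theorem image_scc_isRoot_subset {E : V → V → Prop} {D : Set V}
    (hD : ∀ v, ∃ d ∈ D, ReflTransGen E d v) : scc E '' {v | IsRoot E v} ⊆ scc E '' D := by
  rintro _ ⟨v, hv, rfl⟩
  obtain ⟨d, hd, hdv⟩ := hD v
  exact ⟨d, hd, scc_eq_of_mem ⟨hv d hdv, hdv⟩⟩

/-- One vertex can be chosen from each root component so that every vertex is reachable. -/
theorem exists_ncard_eq_and_forall_reflTransGen [Finite V] (E : V → V → Prop) :
    ∃ D : Set V, D.ncard = (scc E '' {v | IsRoot E v}).ncard ∧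
      ∀ v, ∃ d ∈ D, ReflTransGen E d v := by
  obtain ⟨D, -, hD⟩ := Set.exists_subset_bijOn {v | IsRoot E v} (scc E)
  refine ⟨D, by rw [← hD.image_eq, hD.injOn.ncard_image], fun v => ?_⟩
  obtain ⟨u, hu, huv⟩ := exists_isRoot_reflTransGen E v
  obtain ⟨d, hd, hdu⟩ := hD.surjOn (Set.mem_image_of_mem _ hu)
  have hmem : u ∈ scc E d := hdu ▸ mem_scc_self E u
  exact ⟨d, hd, hmem.1.trans huv⟩

end RelationReachability

/-- The minimal number of driver nodes (a minimum-cardinality set `D` from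
which every vertex is reachable) equals the number of root strongly connected
components of the finite digraph. -/
theorem min_driver_nodes_eq_card_root_SCCs
    {V : Type*} [Finite V] (E : V → V → Prop) :
    sInf {n : ℕ | ∃ D : Set V, D.ncard = n ∧
        ∀ v : V, ∃ d ∈ D, Relation.ReflTransGen E d v}
    = Set.ncard {S : Set V | ∃ v : V,
        (∀ w : V, Relation.ReflTransGen E w v → Relation.ReflTransGen E v w) ∧
        S = {w : V | Relation.ReflTransGen E v w ∧ Relation.ReflTransGen E w v}} := by
  have hroots : {S : Set V | ∃ v : V,
      (∀ w : V, Relation.ReflTransGen E w v → Relation.ReflTransGen E v w) ∧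
      S = {w : V | Relation.ReflTransGen E v w ∧ Relation.ReflTransGen E w v}} =
      RelationReachability.scc E '' {v | RelationReachability.IsRoot E v} :=
    Set.ext fun _ => exists_congr fun _ => and_congr_right fun _ => eq_comm
  rw [hroots]
  refine IsLeast.csInf_eq ⟨RelationReachability.exists_ncard_eq_and_forall_reflTransGen E, ?_⟩
  rintro _ ⟨D, rfl, hD⟩
  exact (Set.ncard_le_ncard (RelationReachability.image_scc_isRoot_subset hD)).trans
    Set.ncard_image_le
end

section
/- Let V be a finite type and E : V → V → Prop an edge relation, with reachability reach = Relation.ReflTransGen E. Call a vertex v a top vertex if every vertex reached by v also reaches v (for all w, reach v w implies reach w v); the strongly connected component of v is SCC(v) = {w | reach v w ∧ reach w v}. Then for any set S ⊆ V, the following are equivalent: (1) every vertex of V can reach some element of S; (2) for every top vertex v, S intersects SCC(v), i.e. there exists s ∈ S with reach v s and reach s v. -/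
open Relation in
/-- In a finite digraph, every vertex reaches a top vertex. -/
theorem exists_reflTransGen_top {V : Type*} [Finite V] (E : V → V → Prop) (v : V) :
    ∃ t, ReflTransGen E v t ∧ ∀ w, ReflTransGen E t w → ReflTransGen E w t := by
  obtain ⟨t, hvt, hmin⟩ := Set.exists_min_image {t | ReflTransGen E v t}
    (fun t => {w | ReflTransGen E t w}.ncard) (Set.toFinite _) ⟨v, .refl⟩
  refine ⟨t, hvt, fun w htw => ?_⟩
  have hsub : {x | ReflTransGen E w x} ⊆ {x | ReflTransGen E t x} := fun x hx => htw.trans hx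
  have heq := Set.eq_of_subset_of_ncard_le hsub (hmin w (ReflTransGen.trans hvt htw))
  exact heq.ge (ReflTransGen.refl : ReflTransGen E t t)

/-- A set `S` of sensor nodes is reachable from every vertex of a finite
digraph iff `S` intersects the strongly connected component of every top
vertex. -/
theorem sensor_set_iff_meets_top_SCCs
    {V : Type*} [Finite V] (E : V → V → Prop) (S : Set V) :
    (∀ v : V, ∃ s ∈ S, Relation.ReflTransGen E v s)
    ↔
    (∀ v : V,
      (∀ w : V, Relation.ReflTransGen E v w → Relation.ReflTransGen E w v) →
      ∃ s ∈ S, Relation.ReflTransGen E v s ∧ Relation.ReflTransGen E s v) := by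
  constructor
  · intro h v hv
    obtain ⟨s, hs, hvs⟩ := h v
    exact ⟨s, hs, hvs, hv s hvs⟩
  · intro h v
    obtain ⟨t, hvt, ht⟩ := exists_reflTransGen_top E v
    obtain ⟨s, hs, hts, -⟩ := h t ht
    exact ⟨s, hs, hvt.trans hts⟩
end

section
/- Let V be a finite type and E : V → V → Prop an edge relation, with reachability reach = Relation.ReflTransGen E; call a vertex v a top vertex if for all w, reach v w implies reach w v, and let SCC(v) = {w | reach v w ∧ reach w v}. Let T ⊆ V be any set that intersects SCC(v) for every top vertex v. Define the extended digraph on Option V whose edge relation E' satisfies: E' (some a) (some b) ↔ E a b, E' (some v) none ↔ v ∈ T, and none has no outgoing edges. Then in this extended digraph every vertex some v (v ∈ V) can reach the single new output vertex none. Consequently, a single output node suffices to render any finite directed graph structurally observable. -/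
/-- In a finite type, every element is related by the reflexive transitive closure of `r` to an
element that can be reached back from everything it reaches. -/
theorem Relation.ReflTransGen.exists_top {α : Type*} [Finite α] (r : α → α → Prop) (a : α) :
    ∃ b, Relation.ReflTransGen r a b ∧
      ∀ c, Relation.ReflTransGen r b c → Relation.ReflTransGen r c b := by
  let _ : Preorder α :=
    { le := Relation.ReflTransGen r
      le_refl := fun _ => .refl
      le_trans := fun _ _ _ => .trans }
  obtain ⟨b, hab, hb⟩ := Set.finite_univ.exists_le_maximal (Set.mem_univ a)
  exact ⟨b, hab, fun c hbc => hb.2 (Set.mem_univ c) hbc⟩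

/-- One output node suffices: if `T` intersects the SCC of every top vertex,
then adding a single new vertex `none` with edges from the elements of `T`
makes `none` reachable from every original vertex. -/
theorem single_output_node_suffices
    {V : Type*} [Finite V] (E : V → V → Prop) (T : Set V)
    (hT : ∀ v : V,
      (∀ w : V, Relation.ReflTransGen E v w → Relation.ReflTransGen E w v) →
      ∃ s ∈ T, Relation.ReflTransGen E v s ∧ Relation.ReflTransGen E s v)
    (E' : Option V → Option V → Prop)
    (hE'1 : ∀ a b : V, E' (some a) (some b) ↔ E a b)
    (hE'2 : ∀ v : V, E' (some v) none ↔ v ∈ T)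
    (hE'3 : ∀ a : Option V, ¬ E' none a) :
    ∀ v : V, Relation.ReflTransGen E' (some v) none := by
  intro v
  obtain ⟨w, hvw, hw⟩ := Relation.ReflTransGen.exists_top E v
  obtain ⟨s, hs, hws, -⟩ := hT w hw
  exact ((hvw.trans hws).lift some fun a b => (hE'1 a b).2).tail ((hE'2 s).2 hs)
end

section
/- Let N, M be positive integers, S ⊆ Fin N a set of state indices, and f : (Fin N → ℝ) → (Fin M → ℝ) → (Fin N → ℝ) a vector field such that the S-components of f depend neither on the input nor on the states outside S: there exists a Lipschitz map g : (S → ℝ) → (S → ℝ) such that for every state x, input value u and every i ∈ S, f x u i = g (the restriction of x to S) i. Let u, ũ : ℝ → (Fin M → ℝ) be any two input signals, and let x, x̃ : ℝ → (Fin N → ℝ) be differentiable trajectories satisfying x'(t) = f (x t) (u t) and x̃'(t) = f (x̃ t) (ũ t) for all t ∈ ℝ. If xᵢ(0) = x̃ᵢ(0) for all i ∈ S, then xᵢ(t) = x̃ᵢ(t) for all t ∈ ℝ and all i ∈ S. (Hence when a set S of state nodes receives no directed path from the inputs, the S-coordinates cannot be influenced by any control, which gives the necessity direction of the structural accessibility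 theorem.) -/
/-- Necessity direction of the structural accessibility theorem: if the
`S`-components of the vector field `f` depend neither on the input nor on the
states outside `S` (through a Lipschitz restricted dynamics `g`), then the
`S`-coordinates of any two trajectories with the same initial `S`-coordinates
coincide for all time, for arbitrary inputs. -/
theorem unreachable_coordinates_uncontrollable
    (N M : ℕ) (hN : 0 < N) (hM : 0 < M) (S : Finset (Fin N))
    (f : (Fin N → ℝ) → (Fin M → ℝ) → (Fin N → ℝ))
    (hf : ∃ g : ({ i : Fin N // i ∈ S } → ℝ) → ({ i : Fin N // i ∈ S } → ℝ),
      (∃ K : NNReal, LipschitzWith K g) ∧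
      ∀ (x : Fin N → ℝ) (u : Fin M → ℝ) (i : { i : Fin N // i ∈ S }),
        f x u (i : Fin N) = g (fun j : { i : Fin N // i ∈ S } => x (j : Fin N)) i)
    (u v : ℝ → (Fin M → ℝ)) (x y : ℝ → (Fin N → ℝ))
    (hx : ∀ t : ℝ, HasDerivAt x (f (x t) (u t)) t)
    (hy : ∀ t : ℝ, HasDerivAt y (f (y t) (v t)) t)
    (h0 : ∀ i ∈ S, x 0 i = y 0 i) :
    ∀ t : ℝ, ∀ i ∈ S, x t i = y t i := by
  obtain ⟨g, ⟨K, hg⟩, hfg⟩ := hf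
  have restrict_hasDerivAt : ∀ (w : ℝ → (Fin M → ℝ)) (z : ℝ → (Fin N → ℝ)),
      (∀ t, HasDerivAt z (f (z t) (w t)) t) → ∀ t,
        HasDerivAt (fun s (j : { i : Fin N // i ∈ S }) => z s j)
          (g (fun j : { i : Fin N // i ∈ S } => z t j)) t := by
    intro w z hz t
    refine hasDerivAt_pi.2 fun i => ?_
    rw [← hfg (z t) (w t) i]
    exact hasDerivAt_pi.1 (hz t) i
  have hxy : (fun s (j : { i : Fin N // i ∈ S }) => x s j) =
      fun s (j : { i : Fin N // i ∈ S }) => y s j :=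
    ODE_solution_unique_univ (v := fun _ => g) (s := fun _ => Set.univ) (t₀ := 0) (K := K)
      (fun _ => hg.lipschitzOnWith)
      (fun t => ⟨restrict_hasDerivAt u x hx t, Set.mem_univ _⟩)
      (fun t => ⟨restrict_hasDerivAt v y hy t, Set.mem_univ _⟩)
      (funext fun j => h0 j j.2)
  exact fun t i hi => congrFun (congrFun hxy t) ⟨i, hi⟩
end

section
/- Let N, M, P be positive integers, S ⊆ Fin N a set of state indices, h : (Fin N → ℝ) → (Fin P → ℝ) an output map, and f : (Fin N → ℝ) → (Fin M → ℝ) → (Fin N → ℝ) a vector field. Assume: (a) h is insensitive to the coordinates in S, i.e. h x = h x' whenever xⱼ = x'ⱼ for all j ∉ S; and (b) the dynamics of the coordinates outside S does not depend on the coordinates in S: there exists a map g : (Sᶜ → ℝ) → (Fin M → ℝ) → (Sᶜ → ℝ), Lipschitz in its first argument uniformly in the second, such that for every x, u and every i ∉ S, f x u i = g (the restriction of x to Sᶜ) u i. Let u : ℝ → (Fin M → ℝ) be a continuous input and let x, x̃ : ℝ → (Fin N → ℝ) be differentiable trajectories with x'(t) = f (x t) (u t) and x̃'(t) = f (x̃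 t) (u t) for all t. If xⱼ(0) = x̃ⱼ(0) for all j ∉ S, then h (x t) = h (x̃ t) for all t ∈ ℝ. (Hence initial states that differ only in coordinates having no directed path to the outputs are indistinguishable from the measured output, which gives the necessity direction of the structural observability theorem.) -/
/-- Necessity direction of the structural observability theorem: if the
output map `h` is insensitive to the coordinates in `S` and the dynamics of
the coordinates outside `S` does not depend on those in `S` (through a
restricted dynamics `g` Lipschitz in the state, uniformly in the input),
then two trajectories driven by the same continuous input whose initial
conditions agree outside `S` produce identical outputs for all time. -/
theorem hidden_coordinates_unobservable
    (N M P : ℕ) (hN : 0 < N) (hM : 0 < M) (hP : 0 < P) (S : Finset (Fin N))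
    (h : (Fin N → ℝ) → (Fin P → ℝ))
    (f : (Fin N → ℝ) → (Fin M → ℝ) → (Fin N → ℝ))
    (hins : ∀ x x' : Fin N → ℝ, (∀ j : Fin N, j ∉ S → x j = x' j) → h x = h x')
    (hf : ∃ g : ({ i : Fin N // i ∉ S } → ℝ) → (Fin M → ℝ) → ({ i : Fin N // i ∉ S } → ℝ),
      (∃ K : NNReal, ∀ u : Fin M → ℝ, LipschitzWith K (fun z => g z u)) ∧
      ∀ (x : Fin N → ℝ) (u : Fin M → ℝ) (i : { i : Fin N // i ∉ S }),
        f x u (i : Fin N) = g (fun j : { i : Fin N // i ∉ S } => x (j : Fin N)) u i)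
    (u : ℝ → (Fin M → ℝ)) (hu : Continuous u)
    (x y : ℝ → (Fin N → ℝ))
    (hx : ∀ t : ℝ, HasDerivAt x (f (x t) (u t)) t)
    (hy : ∀ t : ℝ, HasDerivAt y (f (y t) (u t)) t)
    (h0 : ∀ j : Fin N, j ∉ S → x 0 j = y 0 j) :
    ∀ t : ℝ, h (x t) = h (y t) := by
  obtain ⟨g, ⟨K, hK⟩, hfg⟩ := hf
  let r : (Fin N → ℝ) → ({ i : Fin N // i ∉ S } → ℝ) := fun z j => z j
  have restrict_solves : ∀ z : ℝ → (Fin N → ℝ),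
      (∀ t, HasDerivAt z (f (z t) (u t)) t) →
      ∀ t, HasDerivAt (fun τ => r (z τ)) (g (r (z t)) (u t)) t ∧ r (z t) ∈ Set.univ := by
    refine fun z hz t => ⟨hasDerivAt_pi.2 fun i => ?_, Set.mem_univ _⟩
    rw [← hfg]
    exact hasDerivAt_pi.1 (hz t) i
  have heq : (fun t => r (x t)) = fun t => r (y t) :=
    ODE_solution_unique_univ (v := fun t z => g z (u t)) (t₀ := 0)
      (fun t => (hK (u t)).lipschitzOnWith) (restrict_solves x hx) (restrict_solves y hy)
      (funext fun j => h0 j j.2)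
  exact fun t => hins _ _ fun j hj => congrFun (congrFun heq t) ⟨j, hj⟩
end

section
/- Let u : ℝ → ℝ be any function and let x₁, x₂, x₃ : ℝ → ℝ be differentiable functions satisfying x₁'(t) = x₂(t) + x₃(t)·u(t), x₂'(t) = −x₁(t), and x₃'(t) = −x₁(t)·u(t) for all t ∈ ℝ. Then x₁(t)² + x₂(t)² + x₃(t)² = x₁(0)² + x₂(0)² + x₃(0)² for all t ∈ ℝ. That is, ξ(x) = x₁² + x₂² + x₃² is a conserved quantity for every input, so this nonlinear system is not accessible even though its graph is linearly structurally controllable. -/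
/-- The bilinear system ẋ₁ = x₂ + x₃u, ẋ₂ = −x₁, ẋ₃ = −x₁u conserves
ξ = x₁² + x₂² + x₃² for every input: it has an autonomous element and is
therefore not accessible, even though its graph is linearly structurally
controllable. -/
theorem bilinear_system_conserved_quantity
    (u x₁ x₂ x₃ : ℝ → ℝ)
    (h₁ : ∀ t : ℝ, HasDerivAt x₁ (x₂ t + x₃ t * u t) t)
    (h₂ : ∀ t : ℝ, HasDerivAt x₂ (-(x₁ t)) t)
    (h₃ : ∀ t : ℝ, HasDerivAt x₃ (-(x₁ t) * u t) t) :
    ∀ t : ℝ, (x₁ t) ^ 2 + (x₂ t) ^ 2 + (x₃ t) ^ 2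
      = (x₁ 0) ^ 2 + (x₂ 0) ^ 2 + (x₃ 0) ^ 2 := by
  have hξ : ∀ t, HasDerivAt (fun t => x₁ t ^ 2 + x₂ t ^ 2 + x₃ t ^ 2) 0 t := fun t =>
    ((((h₁ t).fun_pow 2).fun_add ((h₂ t).fun_pow 2)).fun_add ((h₃ t).fun_pow 2)).congr_deriv
      (by push_cast; ring)
  exact fun t => is_const_of_deriv_eq_zero (fun s => (hξ s).differentiableAt)
    (fun s => (hξ s).deriv) t 0
end

section
/- Let d be a positive integer, let c : Fin d → ℝ with cᵢ ≠ 0 for all i, and let a, ã : Fin d → ℝ. If the two trajectories xᵢ(t) = aᵢ + cᵢt and x̃ᵢ(t) = ãᵢ + cᵢt of the system ẋᵢ = cᵢ produce the same output y(t) = ∏ᵢ xᵢ(t) for all t ∈ ℝ, i.e. ∏ᵢ (aᵢ + cᵢt) = ∏ᵢ (ãᵢ + cᵢt) for all t ∈ ℝ, then the multiset {aᵢ/cᵢ : i ∈ Fin d} equals the multiset {ãᵢ/cᵢ : i ∈ Fin d}. In particular, the set of initial conditions producing a given output trajectory is finite (a set of permutations), so the one-layer system with product output is locally observable. -/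
open Polynomial in
/-- Families of real numbers whose monic products of linear factors `u i + t` agree for all `t`
coincide as multisets. -/
theorem map_univ_val_eq_of_prod_add_eq {ι : Type*} [Fintype ι] (u v : ι → ℝ)
    (h : ∀ t : ℝ, ∏ i, (u i + t) = ∏ i, (v i + t)) :
    Multiset.map u Finset.univ.val = Multiset.map v Finset.univ.val := by
  have hpoly : ∏ i, (X - C (-u i)) = ∏ i, (X - C (-v i)) := by
    refine Polynomial.funext fun t => ?_
    simpa [eval_prod, add_comm] using h t
  have hroots (w : ι → ℝ) :
      (∏ i, (X - C (-w i))).roots = Multiset.map (fun i => -w i) Finset.univ.val := by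
    rw [← roots_multiset_prod_X_sub_C (Multiset.map (fun i => -w i) Finset.univ.val),
      Multiset.map_map]
    rfl
  have hneg := congrArg roots hpoly
  rw [hroots, hroots] at hneg
  simpa [Multiset.map_map, Function.comp_def] using congrArg (Multiset.map Neg.neg) hneg

/-- If two trajectories xᵢ(t) = aᵢ + cᵢt and x̃ᵢ(t) = ãᵢ + cᵢt of the
one-layer system ẋᵢ = cᵢ produce the same product output ∏ᵢ xᵢ(t) for all
t ∈ ℝ, then the multisets {aᵢ/cᵢ} and {ãᵢ/cᵢ} coincide: initial conditions
are determined up to a finite set of permutations, so the system is locally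
observable. -/
theorem one_layer_product_output_determines_initial_conditions
    (d : ℕ) (hd : 0 < d) (c : Fin d → ℝ) (hc : ∀ i, c i ≠ 0)
    (a b : Fin d → ℝ)
    (hout : ∀ t : ℝ, ∏ i, (a i + c i * t) = ∏ i, (b i + c i * t)) :
    Multiset.map (fun i => a i / c i) Finset.univ.val
      = Multiset.map (fun i => b i / c i) Finset.univ.val := by
  refine map_univ_val_eq_of_prod_add_eq _ _ fun t => ?_
  have hfactor (w : Fin d → ℝ) :
      ∏ i, (w i + c i * t) = (∏ i, c i) * ∏ i, (w i / c i + t) := by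
    rw [← Finset.prod_mul_distrib]
    refine Finset.prod_congr rfl fun i _ => ?_
    rw [mul_add, mul_div_cancel₀ _ (hc i)]
  have hprod : ∏ i, c i ≠ 0 := Finset.prod_ne_zero_iff.mpr fun i _ => hc i
  refine mul_left_cancel₀ hprod ?_
  rw [← hfactor, ← hfactor, hout t]
end
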